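/- Let N ≥ 2, 1 < p < N, p < q < ∞, p* := Np/(N−p), r > p* with r ≥ q, let a : ℤ^N → [0,∞) be bounded, and let t > 0. Let {v_n} be finitely supported functions on ℤ^N with Σ_{x} |v_n(x)|^r = rt and I(v_n) → S_t, let x_n ∈ ℤ^N satisfy |v_n(x_n)| = ‖v_n‖_∞, and let y_n ∈ ℤ^N be any sequence such that {x_n − y_n} is bounded in ℤ^N. Put u_n(x) := v_n(x + y_n). Then there exist a subsequence (n_k), a function u : ℤ^N → ℝ, a function ã : ℤ^N → [0,∞) with ã(x) = lim_k a(x + y_{n_k}) for every x, and λ > 0, such that: u_{n_k} → u pointwise on ℤ^N; ∫_E |∇(u_{n_k} − u)|^p dw → 0 and ∫_E a(x + y_{n_k})|∇(u_{n_k} − u)|^q dw → 0; ∫_E ((1/p)|∇u|^p + (ã(x)/q)|∇u|^q) dw = S_t; and for every x₀ ∈ ℤ^N, −Σ_{y∼x₀} |u(y)−u(x₀)|^{p−2}(u(y)−u(x₀)) − Σ_{y∼x₀} ((ã(x₀)+ã(y))/2)|u(y)−u(x₀)|^{q−2}(u(y)−u(x₀)) = λ |u(x₀)|^{r−2}u(x₀).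 Moreover, if every v_n is nonnegative, then u(x) > 0 for all x. -/

import Mathlib

open Filter Topology
open scoped ENNReal Classical

noncomputable section

abbrev ZN (N : ℕ) := Fin N → ℤ

def adj {N : ℕ} (x y : ZN N) : Prop := (∑ i, (x i - y i).natAbs) = 1

def eInt {N : ℕ} (g : ZN N → ZN N → ℝ) : ℝ≥0∞ :=
  (∑' e : ZN N × ZN N, if adj e.1 e.2 then ENNReal.ofReal (g e.1 e.2) else 0) / 2

def grad {N : ℕ} (u : ZN N → ℝ) (x y : ZN N) : ℝ := u y - u x

def energy {N : ℕ} (p q : ℝ) (a u : ZN N → ℝ) : ℝ≥0∞ :=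
  eInt (fun x y => (1 / p) * |grad u x y| ^ p + (a x / q) * |grad u x y| ^ q)

def gradModular {N : ℕ} (p q : ℝ) (a u : ZN N → ℝ) : ℝ≥0∞ :=
  eInt (fun x y => |grad u x y| ^ p + a x * |grad u x y| ^ q)

def vsum {N : ℕ} (r : ℝ) (u : ZN N → ℝ) : ℝ≥0∞ :=
  ∑' x : ZN N, ENNReal.ofReal (|u x| ^ r)

def Slevel {N : ℕ} (p q : ℝ) (a : ZN N → ℝ) (r t : ℝ) : ℝ≥0∞ :=
  sInf { c : ℝ≥0∞ | ∃ u : ZN N → ℝ, (Function.support u).Finite ∧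
      vsum r u = ENNReal.ofReal (r * t) ∧ energy p q a u = c }

def Lop {N : ℕ} (p q : ℝ) (a u : ZN N → ℝ) (x₀ : ZN N) : ℝ :=
  -(∑' y : ZN N, if adj x₀ y then |u y - u x₀| ^ (p - 2) * (u y - u x₀) else 0)
    - ∑' y : ZN N, if adj x₀ y then
        ((a x₀ + a y) / 2) * (|u y - u x₀| ^ (q - 2) * (u y - u x₀)) else 0

/-- The weighted power sum `∑ c i |f i| ^ s`, with values in `[0, ∞]`. -/
def wsum {ι : Type*} (c : ι → ℝ) (s : ℝ) (f : ι → ℝ) : ℝ≥0∞ :=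
  ∑' i, ENNReal.ofReal (c i * |f i| ^ s)

section WSum

variable {ι : Type*} {c : ι → ℝ} {s : ℝ}

lemma wsum_mono (hc : ∀ i, 0 ≤ c i) (hs : 0 ≤ s) {f g : ι → ℝ} (h : ∀ i, |f i| ≤ |g i|) :
    wsum c s f ≤ wsum c s g :=
  ENNReal.tsum_le_tsum fun i => ENNReal.ofReal_le_ofReal <|
    mul_le_mul_of_nonneg_left (Real.rpow_le_rpow (abs_nonneg _) (h i) hs) (hc i)

lemma wsum_const_mul (k : ℝ) (f : ι → ℝ) :
    wsum c s (fun i => k * f i) = ENNReal.ofReal (|k| ^ s) * wsum c s f := by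
  unfold wsum
  rw [← ENNReal.tsum_mul_left]
  congr 1 with i
  rw [← ENNReal.ofReal_mul (by positivity), abs_mul, Real.mul_rpow (abs_nonneg _) (abs_nonneg _)]
  congr 1
  ring

lemma summable_of_wsum_ne_top (hc : ∀ i, 0 ≤ c i) {f : ι → ℝ} (h : wsum c s f ≠ ⊤) :
    Summable fun i => c i * |f i| ^ s := by
  have := ENNReal.summable_toReal h
  refine this.congr fun i => ?_
  rw [ENNReal.toReal_ofReal (mul_nonneg (hc i) (by positivity))]

lemma wsum_eq_ofReal (hc : ∀ i, 0 ≤ c i) {f : ι → ℝ} (h : Summable fun i => c i * |f i| ^ s) :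
    wsum c s f = ENNReal.ofReal (∑' i, c i * |f i| ^ s) :=
  (ENNReal.ofReal_tsum_of_nonneg (fun i => mul_nonneg (hc i) (by positivity)) h).symm

lemma wsum_ne_top_iff (hc : ∀ i, 0 ≤ c i) {f : ι → ℝ} :
    wsum c s f ≠ ⊤ ↔ Summable fun i => c i * |f i| ^ s :=
  ⟨summable_of_wsum_ne_top hc, fun h => by rw [wsum_eq_ofReal hc h]; exact ENNReal.ofReal_ne_top⟩

lemma toReal_wsum (hc : ∀ i, 0 ≤ c i) (f : ι → ℝ) :
    (wsum c s f).toReal = ∑' i, c i * |f i| ^ s := by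
  unfold wsum
  rw [ENNReal.tsum_toReal_eq fun i => ENNReal.ofReal_ne_top]
  congr 1 with i
  rw [ENNReal.toReal_ofReal (mul_nonneg (hc i) (by positivity))]

/-- Fatou's lemma for weighted power sums with varying weights. -/
lemma wsum_le_of_tendsto {c : ℕ → ι → ℝ} {d : ι → ℝ} {f : ℕ → ι → ℝ} {g : ι → ℝ} (hs : 0 ≤ s)
    (hcd : ∀ i, Tendsto (fun n => c n i) atTop (𝓝 (d i)))
    (hfg : ∀ i, Tendsto (fun n => f n i) atTop (𝓝 (g i))) {M : ℝ≥0∞}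
    (hM : ∀ n, wsum (c n) s (f n) ≤ M) : wsum d s g ≤ M := by
  unfold wsum
  rw [ENNReal.tsum_eq_iSup_sum]
  refine iSup_le fun F => ?_
  have h : Tendsto (fun n => ∑ i ∈ F, ENNReal.ofReal (c n i * |f n i| ^ s)) atTop
      (𝓝 (∑ i ∈ F, ENNReal.ofReal (d i * |g i| ^ s))) :=
    tendsto_finsetSum _ fun i _ => ENNReal.tendsto_ofReal <|
      (hcd i).mul ((hfg i).abs.rpow_const (Or.inr hs))
  exact le_of_tendsto' h fun n => (ENNReal.sum_le_tsum F).trans (hM n)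

lemma exists_abs_add_rpow_le (hs : 1 ≤ s) {ε : ℝ} (hε : 0 < ε) :
    ∃ C : ℝ, 0 ≤ C ∧ ∀ a b : ℝ, |a + b| ^ s ≤ (1 + ε) * |a| ^ s + C * |b| ^ s := by
  have hlim : Tendsto (fun θ : ℝ => (1 - θ) ^ (1 - s)) (𝓝[>] 0) (𝓝 1) := by
    have : ContinuousAt (fun θ : ℝ => (1 - θ) ^ (1 - s)) 0 :=
      ContinuousAt.rpow_const (by fun_prop) (Or.inl (by norm_num))
    simpa using this.tendsto.mono_left nhdsWithin_le_nhds
  obtain ⟨θ, hθ1, hθ0, hθ2⟩ := ((hlim.eventually (gt_mem_nhds (show (1 : ℝ) < 1 + ε by linarith))).and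
    (Ioo_mem_nhdsGT (show (0 : ℝ) < 1 by norm_num))).exists
  have h1θ : 0 < 1 - θ := by linarith
  refine ⟨θ ^ (1 - s), by positivity, fun a b => ?_⟩
  have key := (convexOn_rpow hs).2 (x := |a| / (1 - θ)) (y := |b| / θ)
    (by simp only [Set.mem_Ici]; positivity) (by simp only [Set.mem_Ici]; positivity)
    h1θ.le hθ0.le (by ring)
  simp only [smul_eq_mul] at key
  rw [mul_div_cancel₀ _ h1θ.ne', mul_div_cancel₀ _ hθ0.ne',
    Real.div_rpow (abs_nonneg _) h1θ.le, Real.div_rpow (abs_nonneg _) hθ0.le] at key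
  have e1 : (1 - θ) * (|a| ^ s / (1 - θ) ^ s) = (1 - θ) ^ (1 - s) * |a| ^ s := by
    rw [Real.rpow_sub h1θ, Real.rpow_one]; ring
  have e2 : θ * (|b| ^ s / θ ^ s) = θ ^ (1 - s) * |b| ^ s := by
    rw [Real.rpow_sub hθ0, Real.rpow_one]; ring
  rw [e1, e2] at key
  calc |a + b| ^ s ≤ (|a| + |b|) ^ s :=
        Real.rpow_le_rpow (abs_nonneg _) (abs_add_le a b) (by linarith)
    _ ≤ _ := key
    _ ≤ _ := by gcongr

lemma exists_abs_rpow_add_sub_le (hs : 1 ≤ s) {ε : ℝ} (hε : 0 < ε) :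
    ∃ C : ℝ, 0 ≤ C ∧ ∀ a b : ℝ,
      |(|a + b| ^ s - |a| ^ s - |b| ^ s)| ≤ ε * |a| ^ s + C * |b| ^ s := by
  set η := min 1 (ε / 2)
  have hη : 0 < η := by positivity
  have hη1 : η ≤ 1 := min_le_left _ _
  have hη2 : η ≤ ε / 2 := min_le_right _ _
  obtain ⟨C, hC, h⟩ := exists_abs_add_rpow_le hs hη
  refine ⟨2 * C + 1, by positivity, fun a b => ?_⟩
  have h1 := h a b
  have h2 := h (a + b) (-b)
  rw [add_neg_cancel_right, abs_neg] at h2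
  have ha : 0 ≤ |a| ^ s := by positivity
  have hb : 0 ≤ |b| ^ s := by positivity
  have h3 := mul_le_mul_of_nonneg_left h1 hη.le
  have h4 := mul_le_mul_of_nonneg_right hη1 ha
  have h5 := mul_le_mul_of_nonneg_left h4 hη.le
  have h6 := mul_le_mul_of_nonneg_right hη2 ha
  have h7 := mul_le_mul_of_nonneg_right hη1 (mul_nonneg hC hb)
  have h8 := mul_nonneg hC hb
  rw [abs_le]
  constructor <;> nlinarith

/-- The Brezis–Lieb lemma for power sums with varying weights. -/
lemma brezis_lieb {c : ℕ → ι → ℝ} {d C : ι → ℝ} (hc : ∀ n i, 0 ≤ c n i)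
    (hcC : ∀ n i, c n i ≤ C i) (hcd : ∀ i, Tendsto (fun n => c n i) atTop (𝓝 (d i)))
    (hs : 1 ≤ s) {f : ℕ → ι → ℝ} {g : ι → ℝ}
    (hfg : ∀ i, Tendsto (fun n => f n i) atTop (𝓝 (g i)))
    {M : ℝ} (hM : ∀ n, wsum (c n) s (f n) ≤ ENNReal.ofReal M) (hg : wsum C s g ≠ ⊤) :
    (∀ n, wsum (c n) s (fun i => f n i - g i) ≠ ⊤) ∧
    Tendsto (fun n => (wsum (c n) s (f n)).toReal
      - (wsum (c n) s (fun i => f n i - g i)).toReal) atTop (𝓝 (wsum d s g).toReal) := by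
  have hC : ∀ i, 0 ≤ C i := fun i => (hc 0 i).trans (hcC 0 i)
  have hd : ∀ i, 0 ≤ d i := fun i => ge_of_tendsto' (hcd i) fun n => hc n i
  have hgS := summable_of_wsum_ne_top hC hg
  have hgn : ∀ n, Summable fun i => c n i * |g i| ^ s := fun n =>
    Summable.of_nonneg_of_le (fun i => mul_nonneg (hc n i) (by positivity))
      (fun i => mul_le_mul_of_nonneg_right (hcC n i) (by positivity)) hgS
  have hfn : ∀ n, Summable fun i => c n i * |f n i| ^ s := fun n =>
    summable_of_wsum_ne_top (hc n) ((hM n).trans_lt ENNReal.ofReal_lt_top).ne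
  obtain ⟨K, hK0, hK⟩ := exists_abs_add_rpow_le hs one_pos
  have hdle : ∀ n i, c n i * |f n i - g i| ^ s ≤
      2 * (c n i * |f n i| ^ s) + K * (c n i * |g i| ^ s) := fun n i => by
    have := mul_le_mul_of_nonneg_left (hK (f n i) (-g i)) (hc n i)
    rw [abs_neg, ← sub_eq_add_neg] at this
    linarith
  have hwn : ∀ n, Summable fun i => c n i * |f n i - g i| ^ s := fun n =>
    Summable.of_nonneg_of_le (fun i => mul_nonneg (hc n i) (by positivity)) (hdle n)
      (((hfn n).mul_left 2).add ((hgn n).mul_left K))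
  refine ⟨fun n => (wsum_ne_top_iff (hc n)).2 (hwn n), ?_⟩
  simp only [toReal_wsum (hc _), toReal_wsum hd]
  obtain ⟨M2, hM20, hM2⟩ : ∃ M2 : ℝ, 0 ≤ M2 ∧ ∀ n, ∑' i, c n i * |f n i - g i| ^ s ≤ M2 := by
    have hsum0 : 0 ≤ ∑' i, C i * |g i| ^ s := tsum_nonneg fun i => mul_nonneg (hC i) (by positivity)
    refine ⟨2 * max M 0 + K * ∑' i, C i * |g i| ^ s, by positivity, fun n => ?_⟩
    calc _ ≤ ∑' i, (2 * (c n i * |f n i| ^ s) + K * (c n i * |g i| ^ s)) :=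
          (hwn n).tsum_le_tsum (hdle n) (((hfn n).mul_left 2).add ((hgn n).mul_left K))
      _ = 2 * (∑' i, c n i * |f n i| ^ s) + K * ∑' i, c n i * |g i| ^ s := by
          rw [((hfn n).mul_left 2).tsum_add ((hgn n).mul_left K), tsum_mul_left, tsum_mul_left]
      _ ≤ _ := by
          gcongr
          · rw [← toReal_wsum (hc n)]
            exact ENNReal.toReal_le_of_le_ofReal (le_max_right _ _)
              ((hM n).trans (ENNReal.ofReal_le_ofReal (le_max_left _ _)))
          · exact hgn n
          · exact hcC n _
  have hdom : Tendsto (fun n => ∑' i, c n i * |g i| ^ s) atTop (𝓝 (∑' i, d i * |g i| ^ s)) :=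
    tendsto_tsum_of_dominated_convergence hgS (fun i => (hcd i).mul_const _)
      (Eventually.of_forall fun n i => by
        rw [Real.norm_of_nonneg (mul_nonneg (hc n i) (by positivity))]
        exact mul_le_mul_of_nonneg_right (hcC n i) (by positivity))
  have hzero : Tendsto (fun n => ∑' i, c n i * (|f n i| ^ s - |f n i - g i| ^ s - |g i| ^ s))
      atTop (𝓝 0) := by
    rw [Metric.tendsto_atTop]
    intro δ hδ
    obtain ⟨B, hB0, hB⟩ := exists_abs_rpow_add_sub_le hs (show 0 < δ / (2 * (M2 + 1)) by positivity)
    set ε := δ / (2 * (M2 + 1)) with hε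
    have hε0 : 0 ≤ ε := by positivity
    set G : ℕ → ι → ℝ := fun n i => |f n i| ^ s - |f n i - g i| ^ s - |g i| ^ s with hG
    have hGle : ∀ n i, |G n i| ≤ ε * |f n i - g i| ^ s + B * |g i| ^ s := fun n i => by
      have := hB (f n i - g i) (g i)
      rwa [sub_add_cancel] at this
    set H : ℕ → ι → ℝ := fun n i => max (|G n i| - ε * |f n i - g i| ^ s) 0 with hH
    have hHle : ∀ n i, H n i ≤ B * |g i| ^ s := fun n i =>
      max_le (by linarith [hGle n i]) (by positivity)
    have hH0 : ∀ n i, 0 ≤ H n i := fun n i => le_max_right _ _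
    have hcH : ∀ n i, c n i * H n i ≤ B * (C i * |g i| ^ s) := fun n i => by
      calc c n i * H n i ≤ C i * (B * |g i| ^ s) :=
            mul_le_mul (hcC n i) (hHle n i) (hH0 n i) (hC i)
        _ = _ := by ring
    have hcHS : ∀ n, Summable fun i => c n i * H n i := fun n =>
      Summable.of_nonneg_of_le (fun i => mul_nonneg (hc n i) (hH0 n i)) (hcH n) (hgS.mul_left B)
    have hHlim : Tendsto (fun n => ∑' i, c n i * H n i) atTop (𝓝 (∑' _ : ι, (0 : ℝ))) := by
      refine tendsto_tsum_of_dominated_convergence (hgS.mul_left B) (fun i => ?_)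
        (Eventually.of_forall fun n i => ?_)
      · have hs0 : 0 ≤ s := by linarith
        have h1 := (hfg i).abs.rpow_const (p := s) (Or.inr hs0)
        have h2 := ((hfg i).sub_const (g i)).abs.rpow_const (p := s) (Or.inr hs0)
        have h3 := (((h1.sub h2).sub_const (|g i| ^ s)).abs.sub (h2.const_mul ε)).max
          (tendsto_const_nhds (x := (0 : ℝ)))
        have h4 := (hcd i).mul h3
        have hs1 : s ≠ 0 := by linarith
        simpa [Real.zero_rpow hs1] using h4
      · rw [Real.norm_of_nonneg (mul_nonneg (hc n i) (hH0 n i))]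
        exact hcH n i
    rw [tsum_zero, Metric.tendsto_atTop] at hHlim
    obtain ⟨n0, hn0⟩ := hHlim (δ / 2) (by positivity)
    refine ⟨n0, fun n hn => ?_⟩
    have hGabs : ∀ i, |c n i * G n i| ≤ c n i * H n i + ε * (c n i * |f n i - g i| ^ s) := fun i => by
      rw [abs_mul, abs_of_nonneg (hc n i)]
      have : |G n i| ≤ H n i + ε * |f n i - g i| ^ s := by
        have := le_max_left (|G n i| - ε * |f n i - g i| ^ s) 0
        simp only [hH]; linarith
      have := mul_le_mul_of_nonneg_left this (hc n i)
      linarith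
    have hbS := (hcHS n).add ((hwn n).mul_left ε)
    have h1 : |∑' i, c n i * G n i| ≤ ∑' i, (c n i * H n i + ε * (c n i * |f n i - g i| ^ s)) := by
      rw [← Real.norm_eq_abs]
      exact tsum_of_norm_bounded hbS.hasSum hGabs
    rw [(hcHS n).tsum_add ((hwn n).mul_left ε), tsum_mul_left] at h1
    have h2 := hn0 n hn
    rw [Real.dist_eq, sub_zero] at h2
    have h3 := le_abs_self (∑' i, c n i * H n i)
    have h4 := mul_le_mul_of_nonneg_left (hM2 n) hε0
    have h5 : ε * M2 < δ / 2 := by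
      rw [hε, div_mul_eq_mul_div, div_lt_div_iff₀ (by positivity) (by norm_num)]
      nlinarith
    rw [Real.dist_eq, sub_zero]
    linarith
  have := hzero.add hdom
  rw [zero_add] at this
  refine this.congr fun n => ?_
  have e : ∀ i, c n i * (|f n i| ^ s - |f n i - g i| ^ s - |g i| ^ s) =
      c n i * |f n i| ^ s - c n i * |f n i - g i| ^ s - c n i * |g i| ^ s := fun i => by ring
  simp only [e]
  rw [((hfn n).sub (hwn n)).tsum_sub (hgn n), (hfn n).tsum_sub (hwn n)]
  ring

/-- Changing a function at finitely many places changes its power sum by a finite sum. -/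
lemma toReal_wsum_eq_add_sum (hc : ∀ i, 0 ≤ c i) {f g : ι → ℝ} (hg : wsum c s g ≠ ⊤) (F : Finset ι)
    (hz : ∀ i ∉ F, c i * (|f i| ^ s - |g i| ^ s) = 0) : wsum c s f ≠ ⊤ ∧
    (wsum c s f).toReal = (wsum c s g).toReal + ∑ i ∈ F, c i * (|f i| ^ s - |g i| ^ s) := by
  have hgS := summable_of_wsum_ne_top hc hg
  have hdS : Summable fun i => c i * (|f i| ^ s - |g i| ^ s) := summable_of_ne_finset_zero hz
  have e : ∀ i, c i * |f i| ^ s = c i * |g i| ^ s + c i * (|f i| ^ s - |g i| ^ s) :=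
    fun i => by ring
  refine ⟨(wsum_ne_top_iff hc).2 ((hgS.add hdS).congr fun i => (e i).symm), ?_⟩
  rw [toReal_wsum hc, toReal_wsum hc, tsum_congr e, hgS.tsum_add hdS, tsum_eq_sum hz]

end WSum

section Sobolev

open MeasureTheory

lemma pi_count_eq_count {N : ℕ} :
    Measure.pi (fun _ : Fin N => (Measure.count : Measure ℤ)) = Measure.count := by
  refine Measure.ext_of_singleton fun f => ?_
  rw [Measure.pi_singleton]
  simp

/-- The grid-lines lemma on the lattice. -/
lemma tsum_rpow_le_of_le_lines {N : ℕ} {θ : ℝ} (hθ : (N : ℝ).HolderConjugate θ)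
    {w f : ZN N → ℝ≥0∞} (h : ∀ i x, w x ≤ ∑' k : ℤ, f (Function.update x i k)) :
    ∑' x, w x ^ θ ≤ (∑' x, f x) ^ θ := by
  have hN1 : (0 : ℝ) < N - 1 := by have := hθ.lt; linarith
  have key := lintegral_prod_lintegral_pow_le (fun _ : Fin N => (Measure.count : Measure ℤ))
    (p := θ) (by simpa using hθ) (f := f) (Measurable.of_discrete)
  rw [pi_count_eq_count] at key
  simp only [lintegral_count, Fintype.card_fin] at key
  refine le_trans (ENNReal.tsum_le_tsum fun x => ?_) key
  calc w x ^ θ = ∏ _i : Fin N, w x ^ (1 / ((N : ℝ) - 1)) := by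
        rw [Finset.prod_const, Finset.card_univ, Fintype.card_fin, ← ENNReal.rpow_natCast,
          ← ENNReal.rpow_mul, hθ.conjugate_eq]
        congr 1
        field_simp
    _ ≤ _ := Finset.prod_le_prod' fun i _ => ENNReal.rpow_le_rpow (h i x) (by positivity)

lemma ofReal_abs_le_tsum_abs_sub {g : ℤ → ℝ} (hg : (Function.support g).Finite) (j : ℤ) :
    ENNReal.ofReal |g j| ≤ ∑' k : ℤ, ENNReal.ofReal |g (k + 1) - g k| := by
  have step : ∀ n : ℕ, ENNReal.ofReal |g j| ≤ ENNReal.ofReal |g (j - n)| +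
      ∑ k ∈ Finset.range n, ENNReal.ofReal |g (j - k - 1 + 1) - g (j - k - 1)| := by
    intro n
    induction n with
    | zero => simp
    | succ n ih =>
      refine ih.trans ?_
      rw [Finset.sum_range_succ, add_left_comm, add_comm]
      rw [add_comm]
      have e1 : j - (n : ℤ) - 1 + 1 = j - n := by ring
      have e2 : j - ((n + 1 : ℕ) : ℤ) = j - n - 1 := by push_cast; ring
      rw [e1, e2, add_comm]
      gcongr
      rw [← ENNReal.ofReal_add (abs_nonneg _) (abs_nonneg _)]
      apply ENNReal.ofReal_le_ofReal
      calc |g (j - n)| = |g (j - n - 1) + (g (j - n) - g (j - n - 1))| := by congr 1; ring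
        _ ≤ _ := abs_add_le _ _
  obtain ⟨n, hn⟩ : ∃ n : ℕ, g (j - n) = 0 := by
    by_contra! hcon
    have hinj : Function.Injective fun n : ℕ => j - (n : ℤ) := fun a b hab => by
      simp only at hab; omega
    exact Set.infinite_range_of_injective hinj
      (hg.subset (by rintro _ ⟨n, rfl⟩; exact hcon n))
  refine (step n).trans ?_
  rw [hn, abs_zero, ENNReal.ofReal_zero, zero_add]
  refine (ENNReal.sum_le_tsum _).trans ?_
  have hinj : Function.Injective fun n : ℕ => j - (n : ℤ) - 1 := fun a b hab => by
    simp only at hab; omega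
  exact ENNReal.tsum_comp_le_tsum_of_injective hinj
    fun k : ℤ => ENNReal.ofReal |g (k + 1) - g k|

lemma abs_rpow_sub_rpow_le {a b γ : ℝ} (ha : 0 ≤ a) (hb : 0 ≤ b) (hγ : 1 ≤ γ) :
    |a ^ γ - b ^ γ| ≤ γ * max a b ^ (γ - 1) * |a - b| := by
  wlog h : b ≤ a generalizing a b
  · rw [abs_sub_comm, max_comm, abs_sub_comm a b]
    exact this hb ha (le_of_not_ge h)
  rcases ha.eq_or_lt with rfl | ha'
  · have : b = 0 := le_antisymm h hb
    simp [this]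
  rw [max_eq_left h, abs_of_nonneg (sub_nonneg.2 (Real.rpow_le_rpow hb h (by linarith))),
    abs_of_nonneg (sub_nonneg.2 h)]
  have hba : 0 ≤ b / a := by positivity
  have key := one_add_mul_self_le_rpow_one_add (s := b / a - 1) (by linarith) hγ
  rw [add_sub_cancel, Real.div_rpow hb ha] at key
  have hpos : 0 < a ^ γ := by positivity
  rw [le_div_iff₀ hpos] at key
  have e : a ^ (γ - 1) = a ^ γ / a := by rw [Real.rpow_sub ha', Real.rpow_one]
  rw [e]
  have : γ * (a ^ γ / a) * (a - b) = a ^ γ - (1 + γ * (b / a - 1)) * a ^ γ := by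
    field_simp
    ring
  linarith

lemma adj_update {N : ℕ} (x : ZN N) (i : Fin N) : adj x (Function.update x i (x i + 1)) := by
  unfold adj
  rw [Finset.sum_eq_single i]
  · simp
  · intro j _ hj
    simp [hj]
  · simp

lemma tsum_line_grad_le {N : ℕ} (p : ℝ) (v : ZN N → ℝ) :
    ∑' z : ZN N × Fin N,
      ENNReal.ofReal (|v (Function.update z.1 z.2 (z.1 z.2 + 1)) - v z.1| ^ p) ≤
    2 * eInt (fun x y => |grad v x y| ^ p) := by
  unfold eInt
  rw [ENNReal.mul_div_cancel two_ne_zero ENNReal.ofNat_ne_top]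
  have hinj : Function.Injective fun z : ZN N × Fin N =>
      (z.1, Function.update z.1 z.2 (z.1 z.2 + 1)) := by
    rintro ⟨x, i⟩ ⟨x', i'⟩ h
    simp only [Prod.mk.injEq] at h
    obtain ⟨rfl, h⟩ := h
    by_contra hne
    have hii : i ≠ i' := fun h' => hne (by rw [h'])
    have := congrFun h i
    simp [hii] at this
  refine le_trans (le_of_eq ?_) (ENNReal.tsum_comp_le_tsum_of_injective hinj _)
  refine tsum_congr fun z => ?_
  rw [if_pos (adj_update _ _)]
  rfl

lemma update_add_one_injective {N : ℕ} (i : Fin N) :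
    Function.Injective fun x : ZN N => Function.update x i (x i + 1) := by
  intro x x' h
  ext j
  have := congrFun h j
  by_cases hj : j = i
  · subst hj; simpa using this
  · simpa [hj] using this

lemma tsum_line_max_le {N : ℕ} {μ r M : ℝ} (hr : 0 < r) (hμ : r ≤ μ)
    (v : ZN N → ℝ) (hM : ∀ z, |v z| ≤ M) :
    ∑' z : ZN N × Fin N,
      ENNReal.ofReal (max |v (Function.update z.1 z.2 (z.1 z.2 + 1))| |v z.1| ^ μ) ≤
    ENNReal.ofReal (M ^ (μ - r)) * (2 * N) * vsum r v := by
  have hpt : ∀ z : ZN N × Fin N,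
      ENNReal.ofReal (max |v (Function.update z.1 z.2 (z.1 z.2 + 1))| |v z.1| ^ μ) ≤
      ENNReal.ofReal (M ^ (μ - r)) *
        (ENNReal.ofReal (|v (Function.update z.1 z.2 (z.1 z.2 + 1))| ^ r) +
          ENNReal.ofReal (|v z.1| ^ r)) := fun z => by
    set a := |v (Function.update z.1 z.2 (z.1 z.2 + 1))|
    set b := |v z.1|
    have ha : 0 ≤ a := abs_nonneg _
    have hb : 0 ≤ b := abs_nonneg _
    have hm : 0 ≤ max a b := le_max_of_le_left ha
    have hmM : max a b ≤ M := max_le (hM _) (hM _)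
    rw [← ENNReal.ofReal_add (by positivity) (by positivity), ← ENNReal.ofReal_mul
      (Real.rpow_nonneg (hm.trans hmM) _)]
    apply ENNReal.ofReal_le_ofReal
    calc max a b ^ μ = max a b ^ (μ - r) * max a b ^ r := by
          rw [← Real.rpow_add_of_nonneg hm (by linarith) hr.le]; congr 1; ring
      _ ≤ M ^ (μ - r) * (a ^ r + b ^ r) := by
          gcongr
          · exact Real.rpow_nonneg (hm.trans hmM) _
          rcases max_choice a b with h | h <;> rw [h]
          · have : 0 ≤ b ^ r := by positivity
            linarith
          · have : 0 ≤ a ^ r := by positivity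
            linarith
  refine (ENNReal.tsum_le_tsum hpt).trans ?_
  rw [ENNReal.tsum_mul_left, mul_assoc]
  gcongr
  rw [ENNReal.tsum_add, two_mul, add_mul]
  have hswap : ∀ f : ZN N × Fin N → ℝ≥0∞, ∑' z, f z = ∑ i, ∑' x, f (x, i) := fun f => by
    rw [ENNReal.tsum_prod', ENNReal.tsum_comm, tsum_fintype]
  have hcard : (N : ℝ≥0∞) * vsum r v = ∑ _i : Fin N, vsum r v := by simp
  rw [hswap, hswap, hcard]
  refine add_le_add (Finset.sum_le_sum fun i _ => ?_) (Finset.sum_le_sum fun i _ => le_rfl)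
  exact ENNReal.tsum_comp_le_tsum_of_injective (update_add_one_injective i)
    fun x => ENNReal.ofReal (|v x| ^ r)

lemma tsum_line_rpow_grad_le {N : ℕ} {p p' r μ γ M : ℝ} (hpp : p'.HolderConjugate p) (hγ : 1 ≤ γ)
    (hμγ : μ = (γ - 1) * p') (hr : 0 < r) (hμ : r ≤ μ) (v : ZN N → ℝ) (hM : ∀ z, |v z| ≤ M) :
    ∑' z : ZN N × Fin N,
      ENNReal.ofReal |(|v (Function.update z.1 z.2 (z.1 z.2 + 1))| ^ γ - |v z.1| ^ γ)| ≤
    ENNReal.ofReal γ * ((ENNReal.ofReal (M ^ (μ - r)) * (2 * N) * vsum r v) ^ (1 / p') *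
      (2 * eInt (fun x y => |grad v x y| ^ p)) ^ (1 / p)) := by
  have hp0 : 0 < p := hpp.symm.pos
  have hp'0 : 0 < p' := hpp.pos
  set F : ZN N × Fin N → ℝ≥0∞ := fun z =>
    ENNReal.ofReal (max |v (Function.update z.1 z.2 (z.1 z.2 + 1))| |v z.1| ^ (γ - 1)) with hF
  set G : ZN N × Fin N → ℝ≥0∞ := fun z =>
    ENNReal.ofReal (|v (Function.update z.1 z.2 (z.1 z.2 + 1)) - v z.1|) with hG
  have h1 : ∀ z : ZN N × Fin N,
      ENNReal.ofReal |(|v (Function.update z.1 z.2 (z.1 z.2 + 1))| ^ γ - |v z.1| ^ γ)| ≤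
      ENNReal.ofReal γ * (F z * G z) := fun z => by
    rw [hF, hG]
    simp only
    have hm : 0 ≤ max |v (Function.update z.1 z.2 (z.1 z.2 + 1))| |v z.1| :=
      le_max_of_le_left (abs_nonneg _)
    rw [← ENNReal.ofReal_mul (by positivity), ← ENNReal.ofReal_mul (by positivity)]
    apply ENNReal.ofReal_le_ofReal
    refine (abs_rpow_sub_rpow_le (abs_nonneg _) (abs_nonneg _) hγ).trans ?_
    rw [← mul_assoc]
    exact mul_le_mul_of_nonneg_left (abs_abs_sub_abs_le _ _) (by positivity)
  let _ : MeasurableSpace (ZN N × Fin N) := ⊤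
  have hH := ENNReal.lintegral_mul_le_Lp_mul_Lq (Measure.count : Measure (ZN N × Fin N)) hpp
    (f := F) (g := G) Measurable.of_discrete.aemeasurable Measurable.of_discrete.aemeasurable
  simp only [lintegral_count, Pi.mul_apply] at hH
  refine (ENNReal.tsum_le_tsum h1).trans ?_
  rw [ENNReal.tsum_mul_left]
  refine mul_le_mul_right (hH.trans ?_) _
  refine mul_le_mul' (ENNReal.rpow_le_rpow ?_ (by positivity))
    (ENNReal.rpow_le_rpow ?_ (by positivity))
  · refine le_trans (le_of_eq (tsum_congr fun z => ?_)) (tsum_line_max_le hr hμ v hM)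
    have hm : 0 ≤ max |v (Function.update z.1 z.2 (z.1 z.2 + 1))| |v z.1| :=
      le_max_of_le_left (abs_nonneg _)
    rw [hF, ENNReal.ofReal_rpow_of_nonneg (by positivity) hp'0.le, ← Real.rpow_mul hm, hμγ]
  · refine le_trans (le_of_eq (tsum_congr fun z => ?_)) (tsum_line_grad_le p v)
    rw [hG, ENNReal.ofReal_rpow_of_nonneg (by positivity) hp0.le]

lemma vsum_le_of_abs_le {N : ℕ} {p p' r μ γ θ M : ℝ} (hpp : p'.HolderConjugate p)
    (hθ : (N : ℝ).HolderConjugate θ) (hγ : 1 ≤ γ) (hγr : γ * θ = r)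
    (hμγ : μ = (γ - 1) * p') (hr : 0 < r) (hμ : r ≤ μ) {v : ZN N → ℝ}
    (hv : (Function.support v).Finite) (hM : ∀ z, |v z| ≤ M) :
    vsum r v ≤ (ENNReal.ofReal γ * ((ENNReal.ofReal (M ^ (μ - r)) * (2 * N) * vsum r v) ^ (1 / p') *
      (2 * eInt (fun x y => |grad v x y| ^ p)) ^ (1 / p))) ^ θ := by
  have hθ0 : 0 < θ := hθ.symm.pos
  have hγ0 : 0 < γ := by linarith
  set f : ZN N → ℝ≥0∞ := fun x => ∑ i : Fin N,
    ENNReal.ofReal |(|v (Function.update x i (x i + 1))| ^ γ - |v x| ^ γ)| with hf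
  have hlines : ∀ i x, ENNReal.ofReal (|v x| ^ γ) ≤ ∑' k : ℤ, f (Function.update x i k) := by
    intro i x
    set g : ℤ → ℝ := fun k => |v (Function.update x i k)| ^ γ with hg
    have hgfin : (Function.support g).Finite := by
      have hinj : Function.Injective fun k : ℤ => Function.update x i k :=
        Function.update_injective x i
      refine (hv.preimage hinj.injOn).subset fun k hk => ?_
      simp only [Set.mem_preimage, Function.mem_support]
      intro h0
      apply hk
      simp [hg, h0, Real.zero_rpow hγ0.ne']
    have h := ofReal_abs_le_tsum_abs_sub hgfin (x i)
    have e : |g (x i)| = |v x| ^ γ := by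
      rw [hg]
      simp only [Function.update_eq_self]
      exact abs_of_nonneg (by positivity)
    rw [e] at h
    refine h.trans (ENNReal.tsum_le_tsum fun k => ?_)
    have := Finset.single_le_sum (s := Finset.univ) (f := fun i' : Fin N =>
      ENNReal.ofReal |(|v (Function.update (Function.update x i k) i'
        ((Function.update x i k) i' + 1))| ^ γ - |v (Function.update x i k)| ^ γ)|)
        (fun _ _ => zero_le) (Finset.mem_univ i)
    simpa using this
  have h1 := tsum_rpow_le_of_le_lines hθ hlines
  have e1 : ∑' x, ENNReal.ofReal (|v x| ^ γ) ^ θ = vsum r v := by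
    unfold vsum
    refine tsum_congr fun x => ?_
    rw [ENNReal.ofReal_rpow_of_nonneg (by positivity) hθ0.le, ← Real.rpow_mul (abs_nonneg _), hγr]
  rw [e1] at h1
  refine h1.trans (ENNReal.rpow_le_rpow ?_ hθ0.le)
  refine le_trans (le_of_eq ?_) (tsum_line_rpow_grad_le hpp hγ hμγ hr hμ v hM)
  rw [ENNReal.tsum_prod']
  exact tsum_congr fun x => (tsum_fintype _).symm

/-- In the supercritical range, functions with prescribed `ℓ^r` norm and bounded gradient energy
have sup norm bounded away from zero. -/
lemma exists_le_of_vsum_eq {N : ℕ} (hN : 2 ≤ N) {p r : ℝ} (hp : 1 < p) (hpN : p < (N : ℝ))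
    (hr : (N : ℝ) * p / ((N : ℝ) - p) < r) {V : ℝ} (hV : 0 < V) {E : ℝ≥0∞} (hE : E ≠ ⊤) :
    ∃ δ : ℝ, 0 < δ ∧ ∀ v : ZN N → ℝ, (Function.support v).Finite →
      vsum r v = ENNReal.ofReal V → eInt (fun x y => |grad v x y| ^ p) ≤ E →
      ∀ M : ℝ, (∀ z, |v z| ≤ M) → δ ≤ M := by
  have hN2 : (2 : ℝ) ≤ N := by exact_mod_cast hN
  have hNp : 0 < (N : ℝ) - p := by linarith
  rw [div_lt_iff₀ hNp] at hr
  have hpp : (p / (p - 1)).HolderConjugate p := (Real.HolderConjugate.conjExponent hp).symm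
  have hθ : (N : ℝ).HolderConjugate ((N : ℝ) / (N - 1)) :=
    Real.HolderConjugate.conjExponent (by linarith)
  set p' := p / (p - 1) with hp'
  set θ := (N : ℝ) / (N - 1) with hθdef
  set γ := r * (N - 1) / N with hγdef
  set μ := (γ - 1) * p' with hμdef
  have hN1 : (0 : ℝ) < N - 1 := by linarith
  have hp1 : (0 : ℝ) < p - 1 := by linarith
  have hr0 : 0 < r := by
    by_contra! h
    have : 0 < (N : ℝ) * p := by positivity
    nlinarith
  have hγr : γ * θ = r := by
    rw [hγdef, hθdef]
    field_simp
  have hμr : r < μ := by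
    rw [hμdef, hp', hγdef, ← mul_div_assoc, lt_div_iff₀ hp1]
    have : (r * (N - 1) / N - 1) * p - r * (p - 1) = (r * (N - p) - N * p) / N := by
      field_simp
      ring
    have h2 : 0 < (r * (N - p) - N * p) / (N : ℝ) := div_pos (by linarith) (by linarith)
    linarith
  have hγ : 1 ≤ γ := by
    by_contra! h
    have : μ < 0 := mul_neg_of_neg_of_pos (by linarith) (by positivity)
    linarith
  have hp'0 : 0 < p' := hpp.pos
  have hθ0 : 0 < θ := hθ.symm.pos
  set Φ : ℝ → ℝ≥0∞ := fun M => (ENNReal.ofReal γ * ((ENNReal.ofReal (M ^ (μ - r)) * (2 * N) *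
    ENNReal.ofReal V) ^ (1 / p') * (2 * E) ^ (1 / p))) ^ θ with hΦ
  have hlim : Tendsto Φ (𝓝 0) (𝓝 0) := by
    have h0 : Tendsto (fun M : ℝ => ENNReal.ofReal (M ^ (μ - r))) (𝓝 0) (𝓝 0) := by
      have := ((Real.continuous_rpow_const (q := μ - r) (by linarith)).tendsto 0)
      rw [Real.zero_rpow (by linarith)] at this
      simpa using ENNReal.tendsto_ofReal this
    have hK : (2 * (N : ℝ≥0∞)) ≠ ⊤ := ENNReal.mul_ne_top ENNReal.ofNat_ne_top (ENNReal.natCast_ne_top N)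
    have h1 := ENNReal.Tendsto.mul_const (b := ENNReal.ofReal V)
      (ENNReal.Tendsto.mul_const h0 (Or.inr hK)) (Or.inr ENNReal.ofReal_ne_top)
    have h2 := ((ENNReal.continuous_rpow_const (y := 1 / p')).tendsto _).comp h1
    have hE' : (2 * E) ^ (1 / p) ≠ ⊤ := ENNReal.rpow_ne_top_of_nonneg (by positivity)
      (ENNReal.mul_ne_top ENNReal.ofNat_ne_top hE)
    have h3 := ENNReal.Tendsto.const_mul (a := ENNReal.ofReal γ)
      (ENNReal.Tendsto.mul_const h2 (Or.inr hE')) (Or.inr ENNReal.ofReal_ne_top)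
    have h4 := ((ENNReal.continuous_rpow_const (y := θ)).tendsto _).comp h3
    have e : (ENNReal.ofReal γ * ((0 * (2 * (N : ℝ≥0∞)) * ENNReal.ofReal V) ^ (1 / p') *
        (2 * E) ^ (1 / p))) ^ θ = 0 := by
      rw [zero_mul, zero_mul, ENNReal.zero_rpow_of_pos (by positivity), zero_mul, mul_zero,
        ENNReal.zero_rpow_of_pos hθ0]
    rw [e] at h4
    exact h4
  obtain ⟨δ, hδ, hδ0⟩ := ((hlim.mono_left nhdsWithin_le_nhds : Tendsto Φ (𝓝[>] 0) (𝓝 0)).eventually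
    (gt_mem_nhds (ENNReal.ofReal_pos.2 hV))).and (self_mem_nhdsWithin) |>.exists
  refine ⟨δ, hδ0, fun v hv hvV hvE M hM => ?_⟩
  by_contra! hlt
  have h := vsum_le_of_abs_le hpp hθ hγ hγr hμdef hr0 hμr.le hv (fun z => (hM z).trans hlt.le)
  rw [hvV] at h
  refine absurd (h.trans ?_) (not_le.2 hδ)
  rw [hΦ]
  have : 0 < p := by linarith
  exact ENNReal.rpow_le_rpow (mul_le_mul_right (mul_le_mul_right
    (ENNReal.rpow_le_rpow (mul_le_mul_right hvE _) (by positivity)) _) _) hθ0.le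

end Sobolev

section Energy

variable {N : ℕ} {s p q r : ℝ}

/-- The weight of an ordered pair of vertices: `1 / 2` on edges, `0` elsewhere. -/
def edgeWeight (e : ZN N × ZN N) : ℝ := if adj e.1 e.2 then 1 / 2 else 0

lemma edgeWeight_nonneg (e : ZN N × ZN N) : 0 ≤ edgeWeight e := by
  unfold edgeWeight; split_ifs <;> norm_num

/-- The weighted Dirichlet `s`-energy `∫_E b |∇u| ^ s`. -/
def dirichlet (b : ZN N → ℝ) (s : ℝ) (u : ZN N → ℝ) : ℝ≥0∞ :=
  wsum (fun e : ZN N × ZN N => edgeWeight e * b e.1) s (fun e => grad u e.1 e.2)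

lemma dirichlet_weight_nonneg {b : ZN N → ℝ} (hb : ∀ z, 0 ≤ b z) (e : ZN N × ZN N) :
    0 ≤ edgeWeight e * b e.1 := mul_nonneg (edgeWeight_nonneg e) (hb _)

lemma eInt_eq_tsum (g : ZN N → ZN N → ℝ) :
    eInt g = ∑' e : ZN N × ZN N, ENNReal.ofReal (edgeWeight e * g e.1 e.2) := by
  unfold eInt edgeWeight
  rw [div_eq_mul_inv, ← ENNReal.tsum_mul_right]
  refine tsum_congr fun e => ?_
  split_ifs
  · rw [ENNReal.ofReal_mul (by norm_num), mul_comm]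
    congr 1
    rw [one_div, ENNReal.ofReal_inv_of_pos two_pos]
    simp
  · simp

lemma eInt_mul_rpow_eq (b : ZN N → ℝ) (s : ℝ) (u : ZN N → ℝ) :
    eInt (fun x y => b x * |grad u x y| ^ s) = dirichlet b s u := by
  rw [eInt_eq_tsum]
  exact tsum_congr fun e => by rw [mul_assoc]

lemma eInt_rpow_eq (s : ℝ) (u : ZN N → ℝ) :
    eInt (fun x y => |grad u x y| ^ s) = dirichlet (fun _ => 1) s u := by
  rw [← eInt_mul_rpow_eq]
  simp

lemma energy_eq (hp : 0 < p) (hq : 0 < q) {a : ZN N → ℝ} (ha : ∀ z, 0 ≤ a z) (u : ZN N → ℝ) :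
    energy p q a u = dirichlet (fun _ => 1 / p) p u + dirichlet (fun z => a z / q) q u := by
  unfold energy dirichlet wsum
  rw [eInt_eq_tsum, ← ENNReal.tsum_add]
  refine tsum_congr fun e => ?_
  have := edgeWeight_nonneg e
  have := ha e.1
  rw [← ENNReal.ofReal_add (by positivity) (by positivity)]
  congr 1
  ring

lemma vsum_eq_wsum (r : ℝ) (u : ZN N → ℝ) : vsum r u = wsum (fun _ => 1) r u := by
  simp [vsum, wsum]

lemma vsum_const_mul (k : ℝ) (u : ZN N → ℝ) :
    vsum r (fun z => k * u z) = ENNReal.ofReal (|k| ^ r) * vsum r u := by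
  rw [vsum_eq_wsum, vsum_eq_wsum, wsum_const_mul]

lemma dirichlet_const_mul (b : ZN N → ℝ) (k : ℝ) (u : ZN N → ℝ) :
    dirichlet b s (fun z => k * u z) = ENNReal.ofReal (|k| ^ s) * dirichlet b s u := by
  unfold dirichlet
  rw [← wsum_const_mul]
  congr 1 with e
  unfold grad
  ring

lemma dirichlet_mono {b : ZN N → ℝ} (hb : ∀ z, 0 ≤ b z) (hs : 0 ≤ s) {u w : ZN N → ℝ}
    (h : ∀ x y, |grad u x y| ≤ |grad w x y|) : dirichlet b s u ≤ dirichlet b s w :=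
  wsum_mono (dirichlet_weight_nonneg hb) hs fun e => h e.1 e.2

lemma dirichlet_mono_weight {b b' : ZN N → ℝ} (h : ∀ z, b z ≤ b' z) (u : ZN N → ℝ) :
    dirichlet b s u ≤ dirichlet b' s u :=
  ENNReal.tsum_le_tsum fun e => ENNReal.ofReal_le_ofReal <|
    mul_le_mul_of_nonneg_right (mul_le_mul_of_nonneg_left (h e.1) (edgeWeight_nonneg e))
      (by positivity)

lemma dirichlet_weight_mul {m : ℝ} (hm : 0 ≤ m) (b : ZN N → ℝ) (u : ZN N → ℝ) :
    dirichlet (fun z => m * b z) s u = ENNReal.ofReal m * dirichlet b s u := by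
  unfold dirichlet wsum
  rw [← ENNReal.tsum_mul_left]
  refine tsum_congr fun e => ?_
  rw [← ENNReal.ofReal_mul hm]
  congr 1
  ring

lemma adj_add_right (x y z : ZN N) : adj (x + z) (y + z) ↔ adj x y := by
  unfold adj
  simp

lemma adj_comm {x y : ZN N} : adj x y ↔ adj y x := by
  unfold adj
  have : ∀ i, (x i - y i).natAbs = (y i - x i).natAbs := fun i => by omega
  simp [this]

lemma vsum_translate (y : ZN N) (u : ZN N → ℝ) : vsum r (fun z => u (z + y)) = vsum r u :=
  (Equiv.addRight y).tsum_eq fun z => ENNReal.ofReal (|u z| ^ r)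

lemma eInt_translate (y : ZN N) (g : ZN N → ZN N → ℝ) :
    eInt (fun x x' => g (x + y) (x' + y)) = eInt g := by
  rw [eInt_eq_tsum, eInt_eq_tsum]
  refine Eq.trans (tsum_congr fun e => ?_) (((Equiv.addRight y).prodCongr
    (Equiv.addRight y)).tsum_eq fun e => ENNReal.ofReal (edgeWeight e * g e.1 e.2))
  simp [edgeWeight, adj_add_right]

lemma energy_translate (a : ZN N → ℝ) (y : ZN N) (u : ZN N → ℝ) :
    energy p q (fun z => a (z + y)) (fun z => u (z + y)) = energy p q a u :=
  eInt_translate y fun x x' => (1 / p) * |grad u x x'| ^ p + (a x / q) * |grad u x x'| ^ q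

lemma finite_adj (x : ZN N) : {y | adj x y}.Finite := by
  refine (Set.finite_Icc (x - 1) (x + 1)).subset fun y hy => ?_
  have h : ∀ i, (x i - y i).natAbs ≤ 1 := fun i => by
    have hy' : ∑ j, (x j - y j).natAbs = 1 := hy
    rw [← hy']
    exact Finset.single_le_sum (f := fun j => (x j - y j).natAbs) (fun _ _ => Nat.zero_le _)
      (Finset.mem_univ i)
  constructor <;> intro i <;> have := h i <;> simp <;> omega

lemma dirichlet_ne_top {b : ZN N → ℝ} (hb : ∀ z, 0 ≤ b z) (hs : 0 < s) {u : ZN N → ℝ}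
    (hu : (Function.support u).Finite) : dirichlet b s u ≠ ⊤ := by
  refine (wsum_ne_top_iff (dirichlet_weight_nonneg hb)).2 ?_
  have hfin : (⋃ x ∈ Function.support u, (fun y => (x, y)) '' {y | adj x y} ∪
      (fun y => (y, x)) '' {y | adj x y}).Finite :=
    hu.biUnion fun x _ => ((finite_adj x).image _).union ((finite_adj x).image _)
  refine summable_of_hasFiniteSupport (hfin.subset fun e he => ?_)
  simp only [Function.mem_support] at he
  have hadj : adj e.1 e.2 := by
    by_contra h
    exact he (by simp [edgeWeight, h])
  have hgrad : u e.1 ≠ 0 ∨ u e.2 ≠ 0 := by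
    by_contra! h
    exact he (by simp [grad, h.1, h.2, Real.zero_rpow hs.ne'])
  simp only [Set.mem_iUnion]
  rcases hgrad with h | h
  · exact ⟨e.1, h, Or.inl ⟨e.2, hadj, rfl⟩⟩
  · exact ⟨e.2, h, Or.inr ⟨e.1, adj_comm.1 hadj, rfl⟩⟩

lemma energy_const_mul (hp : 0 < p) (hq : 0 < q) {a : ZN N → ℝ} (ha : ∀ z, 0 ≤ a z) {k : ℝ}
    (hk : 0 ≤ k) (u : ZN N → ℝ) :
    energy p q a (fun z => k * u z) = ENNReal.ofReal (k ^ p) * dirichlet (fun _ => 1 / p) p u +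
      ENNReal.ofReal (k ^ q) * dirichlet (fun z => a z / q) q u := by
  rw [energy_eq hp hq ha, dirichlet_const_mul, dirichlet_const_mul, abs_of_nonneg hk]

lemma energy_const_mul_le (hp : 0 < p) (hpq : p ≤ q) {a : ZN N → ℝ} (ha : ∀ z, 0 ≤ a z) {k : ℝ}
    (hk : 1 ≤ k) (u : ZN N → ℝ) :
    energy p q a (fun z => k * u z) ≤ ENNReal.ofReal (k ^ q) * energy p q a u := by
  have hq : 0 < q := hp.trans_le hpq
  rw [energy_const_mul hp hq ha (by linarith), energy_eq hp hq ha, mul_add]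
  gcongr

lemma energy_mono (hp : 0 < p) (hq : 0 < q) {a : ZN N → ℝ} (ha : ∀ z, 0 ≤ a z) {u w : ZN N → ℝ}
    (h : ∀ x y, |grad u x y| ≤ |grad w x y|) : energy p q a u ≤ energy p q a w := by
  rw [energy_eq hp hq ha, energy_eq hp hq ha]
  exact add_le_add (dirichlet_mono (fun _ => by positivity) hp.le h)
    (dirichlet_mono (fun z => div_nonneg (ha z) hq.le) hq.le h)

/-- Soft thresholding at level `ε`. -/
def softThreshold (ε x : ℝ) : ℝ := max (x - ε) 0 + min (x + ε) 0

lemma abs_softThreshold_sub_le {ε : ℝ} (hε : 0 ≤ ε) (x y : ℝ) :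
    |softThreshold ε x - softThreshold ε y| ≤ |x - y| := by
  unfold softThreshold
  grind

lemma softThreshold_eq_zero {ε x : ℝ} (h : |x| ≤ ε) : softThreshold ε x = 0 := by
  unfold softThreshold
  grind

lemma abs_softThreshold_sub_self_le {ε : ℝ} (hε : 0 ≤ ε) (x : ℝ) :
    |softThreshold ε x - x| ≤ ε := by
  unfold softThreshold
  grind

lemma abs_softThreshold_le {ε : ℝ} (hε : 0 ≤ ε) (x : ℝ) : |softThreshold ε x| ≤ |x| := by
  have := abs_softThreshold_sub_le hε x 0
  rwa [softThreshold_eq_zero (x := 0) (by simpa), sub_zero, sub_zero] at this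

lemma abs_le_of_vsum_le {V : ℝ} (hV : 0 ≤ V) (hr : 0 < r) {u : ZN N → ℝ}
    (h : vsum r u ≤ ENNReal.ofReal V) (z : ZN N) : |u z| ≤ V ^ (1 / r) := by
  have h1 : ENNReal.ofReal (|u z| ^ r) ≤ ENNReal.ofReal V :=
    (ENNReal.le_tsum (f := fun z => ENNReal.ofReal (|u z| ^ r)) z).trans h
  have h2 := (ENNReal.ofReal_le_ofReal_iff hV).1 h1
  have h3 := Real.rpow_le_rpow (by positivity) h2 (show 0 ≤ 1 / r by positivity)
  rwa [← Real.rpow_mul (abs_nonneg _), mul_one_div_cancel hr.ne', Real.rpow_one] at h3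

lemma finite_lt_abs_of_vsum_ne_top (hr : 0 < r) {u : ZN N → ℝ} (h : vsum r u ≠ ⊤) {ε : ℝ}
    (hε : 0 < ε) : {z | ε < |u z|}.Finite := by
  rw [vsum_eq_wsum, wsum_ne_top_iff fun _ => zero_le_one] at h
  have := h.tendsto_cofinite_zero.eventually (gt_mem_nhds (show 0 < ε ^ r by positivity))
  rw [Filter.eventually_cofinite] at this
  refine this.subset fun z hz => ?_
  simp only [Set.mem_ofPred_eq, one_mul, not_lt] at hz ⊢
  exact Real.rpow_le_rpow hε.le hz.le hr.le

/-- A lower bound for the energy on the constraint set extends from finitely supported functions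
to all functions. -/
lemma le_energy_of_forall_finite (hp : 0 < p) (hpq : p ≤ q) (hr : 0 < r) {b : ZN N → ℝ}
    (hb : ∀ z, 0 ≤ b z) {V : ℝ} (hV : 0 < V) {S : ℝ≥0∞}
    (hS : ∀ w : ZN N → ℝ, (Function.support w).Finite → vsum r w = ENNReal.ofReal V →
      S ≤ energy p q b w) (w : ZN N → ℝ) (hw : vsum r w = ENNReal.ofReal V) :
    S ≤ energy p q b w := by
  have hq : 0 < q := hp.trans_le hpq
  set ε : ℕ → ℝ := fun n => 1 / ((n : ℝ) + 1) with hε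
  have hε0 : ∀ n, 0 < ε n := fun n => Nat.one_div_pos_of_nat
  have hεlim : Tendsto ε atTop (𝓝 0) := tendsto_one_div_add_atTop_nhds_zero_nat
  set wn : ℕ → ZN N → ℝ := fun n z => softThreshold (ε n) (w z) with hwn
  have hwtop : vsum r w ≠ ⊤ := by rw [hw]; exact ENNReal.ofReal_ne_top
  have hfin : ∀ n, (Function.support (wn n)).Finite := fun n =>
    (finite_lt_abs_of_vsum_ne_top hr hwtop (hε0 n)).subset fun z hz => by
      by_contra h
      exact hz (softThreshold_eq_zero (not_lt.1 h))
  have hle : ∀ n, vsum r (wn n) ≤ vsum r w := fun n => by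
    rw [vsum_eq_wsum, vsum_eq_wsum]
    exact wsum_mono (fun _ => zero_le_one) hr.le fun z => abs_softThreshold_le (hε0 n).le _
  have htop : ∀ n, vsum r (wn n) ≠ ⊤ := fun n => ((hle n).trans_lt (lt_top_iff_ne_top.2 hwtop)).ne
  have hVw : (vsum r w).toReal = V := by rw [hw, ENNReal.toReal_ofReal hV.le]
  have hVle : ∀ n, (vsum r (wn n)).toReal ≤ V := fun n => by
    rw [← hVw]; exact ENNReal.toReal_mono hwtop (hle n)
  have hVlim : Tendsto (fun n => (vsum r (wn n)).toReal) atTop (𝓝 V) := by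
    rw [← hVw]
    simp only [vsum_eq_wsum, toReal_wsum (c := fun _ : ZN N => (1 : ℝ)) (fun _ => zero_le_one)]
    rw [vsum_eq_wsum, wsum_ne_top_iff fun _ => zero_le_one] at hwtop
    refine tendsto_tsum_of_dominated_convergence hwtop (fun z => ?_)
      (Eventually.of_forall fun n z => ?_)
    · have : Tendsto (fun n => wn n z) atTop (𝓝 (w z)) := by
        rw [tendsto_iff_dist_tendsto_zero]
        exact squeeze_zero (fun _ => dist_nonneg)
          (fun n => abs_softThreshold_sub_self_le (hε0 n).le _) hεlim
      exact (this.abs.rpow_const (Or.inr hr.le)).const_mul 1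
    · rw [Real.norm_of_nonneg (by positivity), one_mul, one_mul]
      exact Real.rpow_le_rpow (abs_nonneg _) (abs_softThreshold_le (hε0 n).le _) hr.le
  set k : ℕ → ℝ := fun n => (V / (vsum r (wn n)).toReal) ^ (1 / r) with hk
  have hklim : Tendsto (fun n => ENNReal.ofReal (k n ^ q) * energy p q b w) atTop
      (𝓝 (energy p q b w)) := by
    have h1 : Tendsto (fun n => V / (vsum r (wn n)).toReal) atTop (𝓝 1) := by
      have := (tendsto_const_nhds (x := V)).div hVlim hV.ne'
      rwa [div_self hV.ne'] at this
    have h2 : Tendsto (fun n => ENNReal.ofReal (k n ^ q)) atTop (𝓝 1) := by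
      have := ENNReal.tendsto_ofReal ((h1.rpow_const (p := 1 / r) (Or.inl one_ne_zero)).rpow_const
        (p := q) (Or.inr hq.le))
      simpa only [Real.one_rpow, ENNReal.ofReal_one] using this
    simpa using ENNReal.Tendsto.mul_const h2 (Or.inl one_ne_zero)
  refine ge_of_tendsto hklim ?_
  filter_upwards [hVlim.eventually (lt_mem_nhds hV)] with n hn
  have hk1 : 1 ≤ k n := Real.one_le_rpow ((one_le_div hn).2 (hVle n)) (by positivity)
  have hkr : k n ^ r = V / (vsum r (wn n)).toReal := by
    rw [hk]
    simp only
    rw [← Real.rpow_mul (by positivity), one_div_mul_cancel hr.ne', Real.rpow_one]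
  calc S ≤ energy p q b (fun z => k n * wn n z) := by
        refine hS _ ((hfin n).subset fun z hz => ?_) ?_
        · exact right_ne_zero_of_mul hz
        · rw [vsum_const_mul, abs_of_nonneg (by linarith), hkr, ← ENNReal.ofReal_toReal (htop n),
            ← ENNReal.ofReal_mul (by positivity)]
          congr 1
          rw [ENNReal.toReal_ofReal ENNReal.toReal_nonneg]
          field_simp
    _ ≤ ENNReal.ofReal (k n ^ q) * energy p q b (wn n) := energy_const_mul_le hp hpq hb hk1 _
    _ ≤ _ := mul_le_mul_right
        (energy_mono hp hq hb fun x y => abs_softThreshold_sub_le (hε0 n).le _ _) _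

/-- Rescaling onto the constraint set, in real form. -/
lemma le_rescaled_energy (hp : 0 < p) (hq : 0 < q) (hr : 0 < r) {b : ZN N → ℝ}
    (hb : ∀ z, 0 ≤ b z) {V : ℝ} (hV : 0 < V) {S : ℝ≥0∞}
    (hS : ∀ w : ZN N → ℝ, vsum r w = ENNReal.ofReal V → S ≤ energy p q b w)
    {w : ZN N → ℝ} (hw : vsum r w ≠ ⊤) (hw0 : 0 < (vsum r w).toReal)
    (hA : dirichlet (fun _ => 1 / p) p w ≠ ⊤) (hB : dirichlet (fun z => b z / q) q w ≠ ⊤) :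
    S.toReal ≤ (V / (vsum r w).toReal) ^ (p / r) * (dirichlet (fun _ => 1 / p) p w).toReal +
      (V / (vsum r w).toReal) ^ (q / r) * (dirichlet (fun z => b z / q) q w).toReal := by
  set ρ := V / (vsum r w).toReal with hρ
  have hρ0 : 0 < ρ := by positivity
  have h := hS (fun z => ρ ^ (1 / r) * w z) (by
    rw [vsum_const_mul, abs_of_nonneg (by positivity), ← Real.rpow_mul hρ0.le,
      one_div_mul_cancel hr.ne', Real.rpow_one, ← ENNReal.ofReal_toReal hw,
      ← ENNReal.ofReal_mul (by positivity), hρ]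
    congr 1
    field_simp)
  rw [energy_const_mul hp hq hb (by positivity), ← Real.rpow_mul hρ0.le, ← Real.rpow_mul hρ0.le,
    one_div_mul_eq_div, one_div_mul_eq_div] at h
  have h1 := ENNReal.mul_ne_top (ENNReal.ofReal_ne_top (r := ρ ^ (p / r))) hA
  have h2 := ENNReal.mul_ne_top (ENNReal.ofReal_ne_top (r := ρ ^ (q / r))) hB
  have h3 := ENNReal.toReal_mono (ENNReal.add_ne_top.2 ⟨h1, h2⟩) h
  rwa [ENNReal.toReal_add h1 h2, ENNReal.toReal_mul, ENNReal.toReal_mul,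
    ENNReal.toReal_ofReal (by positivity), ENNReal.toReal_ofReal (by positivity)] at h3

end Energy

section EulerLagrange

variable {N : ℕ} {s p q r : ℝ}

/-- The neighbours of a vertex. -/
def nbrs (x : ZN N) : Finset (ZN N) := (finite_adj x).toFinset

lemma mem_nbrs {x y : ZN N} : y ∈ nbrs x ↔ adj x y := by simp [nbrs]

lemma not_adj_self (x : ZN N) : ¬ adj x x := by simp [adj]

lemma dirichlet_add_single {b : ZN N → ℝ} (hb : ∀ z, 0 ≤ b z) {u : ZN N → ℝ}
    (hu : dirichlet b s u ≠ ⊤) (x₀ : ZN N) (ε : ℝ) :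
    dirichlet b s (fun z => u z + if z = x₀ then ε else 0) ≠ ⊤ ∧
    (dirichlet b s (fun z => u z + if z = x₀ then ε else 0)).toReal = (dirichlet b s u).toReal +
      ∑ y ∈ nbrs x₀, (b x₀ + b y) / 2 * (|u y - u x₀ - ε| ^ s - |u y - u x₀| ^ s) := by
  have hinj1 : Function.Injective fun y : ZN N => (x₀, y) := fun _ _ h => (Prod.mk.inj h).2
  have hinj2 : Function.Injective fun y : ZN N => (y, x₀) := fun _ _ h => (Prod.mk.inj h).1
  have hdisj : Disjoint ((nbrs x₀).image fun y => (x₀, y)) ((nbrs x₀).image fun y => (y, x₀)) := by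
    rw [Finset.disjoint_left]
    simp only [Finset.mem_image, not_exists, not_and]
    rintro _ ⟨y, hy, rfl⟩ y' hy' h
    have := (Prod.mk.inj h).1
    subst this
    exact not_adj_self _ (mem_nbrs.1 hy')
  obtain ⟨h1, h2⟩ := toReal_wsum_eq_add_sum (dirichlet_weight_nonneg hb) hu
    (f := fun e => grad (fun z => u z + if z = x₀ then ε else 0) e.1 e.2)
    (((nbrs x₀).image fun y => (x₀, y)) ∪ ((nbrs x₀).image fun y => (y, x₀))) (by
      rintro ⟨x, y⟩ hF
      by_cases hadj : adj x y
      · have hx : x ≠ x₀ := by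
          rintro rfl
          exact hF (Finset.mem_union_left _ (Finset.mem_image_of_mem _ (mem_nbrs.2 hadj)))
        have hy : y ≠ x₀ := by
          rintro rfl
          exact hF (Finset.mem_union_right _
            (Finset.mem_image.2 ⟨x, mem_nbrs.2 (adj_comm.1 hadj), rfl⟩))
        simp [grad, hx, hy]
      · simp [edgeWeight, hadj])
  refine ⟨h1, h2.trans ?_⟩
  rw [Finset.sum_union hdisj, Finset.sum_image hinj1.injOn, Finset.sum_image hinj2.injOn,
    ← Finset.sum_add_distrib]
  refine congrArg₂ (· + ·) rfl (Finset.sum_congr rfl fun y hy => ?_)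
  have hadj := mem_nbrs.1 hy
  have hne : y ≠ x₀ := by
    rintro rfl
    exact not_adj_self _ hadj
  simp only [edgeWeight, grad, hadj, adj_comm.1 hadj, if_true, hne, if_false, add_zero]
  rw [abs_sub_comm (u x₀ + ε), abs_sub_comm (u x₀), sub_add_eq_sub_sub]
  ring

lemma vsum_add_single {u : ZN N → ℝ} (hu : vsum r u ≠ ⊤) (x₀ : ZN N) (ε : ℝ) :
    vsum r (fun z => u z + if z = x₀ then ε else 0) ≠ ⊤ ∧
    (vsum r (fun z => u z + if z = x₀ then ε else 0)).toReal =
      (vsum r u).toReal + (|u x₀ + ε| ^ r - |u x₀| ^ r) := by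
  rw [vsum_eq_wsum] at hu ⊢
  obtain ⟨h1, h2⟩ := toReal_wsum_eq_add_sum (fun _ => zero_le_one) hu
    (f := fun z => u z + if z = x₀ then ε else 0) {x₀} (by
      intro z hz
      rw [Finset.mem_singleton] at hz
      simp [hz])
  refine ⟨h1, h2.trans ?_⟩
  simp [vsum_eq_wsum]

lemma hasDerivAt_sum_nbrs (hs : 1 < s) (b : ZN N → ℝ) (u : ZN N → ℝ) (x₀ : ZN N) (D : ℝ) :
    HasDerivAt (fun ε => D +
      ∑ y ∈ nbrs x₀, (b x₀ + b y) / 2 * (|u y - u x₀ - ε| ^ s - |u y - u x₀| ^ s))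
      (-∑ y ∈ nbrs x₀, (b x₀ + b y) / 2 * (s * (|u y - u x₀| ^ (s - 2) * (u y - u x₀)))) 0 := by
  rw [← Finset.sum_neg_distrib]
  refine (HasDerivAt.fun_sum fun y _ => ?_).const_add D
  have h1 : HasDerivAt (fun ε : ℝ => u y - u x₀ - ε) (-1) 0 := (hasDerivAt_id 0).const_sub _
  have h2 : HasDerivAt (fun x => |x| ^ s)
      (s * |u y - u x₀ - 0| ^ (s - 2) * (u y - u x₀ - 0)) (u y - u x₀ - 0) :=
    hasDerivAt_abs_rpow _ hs
  have h3 := ((h2.comp (0 : ℝ) h1).sub_const (|u y - u x₀| ^ s)).const_mul ((b x₀ + b y) / 2)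
  refine h3.congr_deriv ?_
  rw [sub_zero]
  ring

lemma Lop_eq (a u : ZN N → ℝ) (x₀ : ZN N) : Lop p q a u x₀ =
    -(∑ y ∈ nbrs x₀, |u y - u x₀| ^ (p - 2) * (u y - u x₀))
      - ∑ y ∈ nbrs x₀, ((a x₀ + a y) / 2) * (|u y - u x₀| ^ (q - 2) * (u y - u x₀)) := by
  unfold Lop
  have h : ∀ f : ZN N → ℝ, (∑' y, if adj x₀ y then f y else 0) = ∑ y ∈ nbrs x₀, f y := fun f => by
    rw [tsum_eq_sum (s := nbrs x₀) fun y hy => if_neg fun h => hy (mem_nbrs.2 h)]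
    exact Finset.sum_congr rfl fun y hy => if_pos (mem_nbrs.1 hy)
  rw [h, h]

/-- Minimizers of the energy under the `ℓ^r` constraint solve the Euler–Lagrange equation. -/
lemma Lop_eq_of_isMinimizer (hp : 1 < p) (hq : 1 < q) (hr : 1 < r) {b : ZN N → ℝ}
    (hb : ∀ z, 0 ≤ b z) {V : ℝ} (hV : 0 < V) {S : ℝ≥0∞}
    (hS : ∀ w : ZN N → ℝ, vsum r w = ENNReal.ofReal V → S ≤ energy p q b w)
    {u : ZN N → ℝ} (hu : vsum r u = ENNReal.ofReal V)
    (hA : dirichlet (fun _ => 1 / p) p u ≠ ⊤) (hB : dirichlet (fun z => b z / q) q u ≠ ⊤)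
    (huS : energy p q b u = S) (x₀ : ZN N) :
    Lop p q b u x₀ = (p * (dirichlet (fun _ => 1 / p) p u).toReal +
      q * (dirichlet (fun z => b z / q) q u).toReal) / V * (|u x₀| ^ (r - 2) * u x₀) := by
  have hp0 : 0 < p := by linarith
  have hq0 : 0 < q := by linarith
  have hr0 : 0 < r := by linarith
  have hutop : vsum r u ≠ ⊤ := by rw [hu]; exact ENNReal.ofReal_ne_top
  have huV : (vsum r u).toReal = V := by rw [hu, ENNReal.toReal_ofReal hV.le]
  have hbp : ∀ z : ZN N, 0 ≤ (fun _ : ZN N => 1 / p) z := fun _ => by positivity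
  have hbq : ∀ z : ZN N, 0 ≤ (fun z => b z / q) z := fun z => div_nonneg (hb z) hq0.le
  set A := (dirichlet (fun _ => 1 / p) p u).toReal with hAdef
  set B := (dirichlet (fun z => b z / q) q u).toReal with hBdef
  have hSAB : S.toReal = A + B := by
    rw [← huS, energy_eq hp0 hq0 hb, ENNReal.toReal_add hA hB]
  set W : ℝ → ℝ := fun ε => V + (|u x₀ + ε| ^ r - |u x₀| ^ r) with hW
  set Aε : ℝ → ℝ := fun ε => A + ∑ y ∈ nbrs x₀, (1 / p + 1 / p) / 2 *
    (|u y - u x₀ - ε| ^ p - |u y - u x₀| ^ p) with hAε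
  set Bε : ℝ → ℝ := fun ε => B + ∑ y ∈ nbrs x₀, (b x₀ / q + b y / q) / 2 *
    (|u y - u x₀ - ε| ^ q - |u y - u x₀| ^ q) with hBε
  have hWd : HasDerivAt W (r * (|u x₀| ^ (r - 2) * u x₀)) 0 := by
    have h1 : HasDerivAt (fun ε : ℝ => u x₀ + ε) 1 0 := (hasDerivAt_id 0).const_add _
    have h2 : HasDerivAt (fun x => |x| ^ r) (r * |u x₀ + 0| ^ (r - 2) * (u x₀ + 0)) (u x₀ + 0) :=
      hasDerivAt_abs_rpow _ hr
    refine (((h2.comp (0 : ℝ) h1).sub_const (|u x₀| ^ r)).const_add V).congr_deriv ?_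
    rw [add_zero]
    ring
  have hAd := hasDerivAt_sum_nbrs hp (fun _ => 1 / p) u x₀ A
  have hBd := hasDerivAt_sum_nbrs hq (fun z => b z / q) u x₀ B
  have hW0 : W 0 = V := by simp [hW]
  have hA0 : Aε 0 = A := by simp [hAε]
  have hB0 : Bε 0 = B := by simp [hBε]
  have hWpos : ∀ᶠ ε in 𝓝 0, 0 < W ε :=
    hWd.continuousAt.tendsto.eventually (lt_mem_nhds (by rw [hW0]; exact hV))
  have hpow : ∀ m : ℝ, HasDerivAt (fun ε => (V / W ε) ^ (m / r))
      (-(m * (|u x₀| ^ (r - 2) * u x₀) / V)) 0 := fun m => by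
    have h1 : HasDerivAt (fun ε => V / W ε) _ 0 :=
      (hasDerivAt_const (0 : ℝ) V).fun_div hWd (by rw [hW0]; exact hV.ne')
    have h2 := h1.rpow_const (p := m / r) (Or.inl (by rw [hW0, div_self hV.ne']; exact one_ne_zero))
    refine h2.congr_deriv ?_
    rw [hW0, div_self hV.ne', Real.one_rpow]
    field_simp
    ring
  have hmin : IsLocalMin (fun ε => (V / W ε) ^ (p / r) * Aε ε + (V / W ε) ^ (q / r) * Bε ε) 0 := by
    filter_upwards [hWpos] with ε hε
    rw [hW0, hA0, hB0, div_self hV.ne', Real.one_rpow, Real.one_rpow, one_mul, one_mul, ← hSAB]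
    obtain ⟨ha1, ha2⟩ := dirichlet_add_single hbp hA x₀ ε
    obtain ⟨hb1, hb2⟩ := dirichlet_add_single hbq hB x₀ ε
    obtain ⟨hv1, hv2⟩ := vsum_add_single hutop x₀ ε
    rw [huV] at hv2
    have := le_rescaled_energy hp0 hq0 hr0 hb hV hS hv1 (by rw [hv2]; exact hε) ha1 hb1
    rw [hv2, ha2, hb2] at this
    exact this
  have hderiv := hmin.hasDerivAt_eq_zero (((hpow p).mul hAd).add ((hpow q).mul hBd))
  simp only [sub_zero, sub_self, mul_zero, Finset.sum_const_zero, add_zero] at hderiv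
  rw [hW0, div_self hV.ne', Real.one_rpow, Real.one_rpow] at hderiv
  have eA : ∑ y ∈ nbrs x₀, (1 / p + 1 / p) / 2 * (p * (|u y - u x₀| ^ (p - 2) * (u y - u x₀))) =
      ∑ y ∈ nbrs x₀, |u y - u x₀| ^ (p - 2) * (u y - u x₀) :=
    Finset.sum_congr rfl fun y _ => by field_simp; ring
  have eB : ∑ y ∈ nbrs x₀, (b x₀ / q + b y / q) / 2 *
        (q * (|u y - u x₀| ^ (q - 2) * (u y - u x₀))) =
      ∑ y ∈ nbrs x₀, (b x₀ + b y) / 2 * (|u y - u x₀| ^ (q - 2) * (u y - u x₀)) :=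
    Finset.sum_congr rfl fun y _ => by field_simp
  rw [eA, eB, hB0] at hderiv
  rw [Lop_eq]
  have : (p * A + q * B) / V * (|u x₀| ^ (r - 2) * u x₀) =
    p * (|u x₀| ^ (r - 2) * u x₀) / V * A + q * (|u x₀| ^ (r - 2) * u x₀) / V * B := by ring
  rw [this]
  linarith

end EulerLagrange

section Connected

variable {N : ℕ} {s p q r : ℝ}

/-- The lattice graph is connected. -/
lemma forall_of_adj {P : ZN N → Prop} {x₀ : ZN N} (h₀ : P x₀)
    (h : ∀ x y, adj x y → P x → P y) (z : ZN N) : P z := by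
  induction hn : ∑ i, (z i - x₀ i).natAbs using Nat.strong_induction_on generalizing z with
  | _ n ih =>
    by_cases hz : z = x₀
    · exact hz ▸ h₀
    obtain ⟨i, hi⟩ := Function.ne_iff.1 hz
    have key : ∀ k : ℤ, (k - x₀ i).natAbs < (z i - x₀ i).natAbs →
        P (Function.update z i k) := fun k hk => by
      refine ih _ ?_ _ rfl
      rw [← hn]
      refine Finset.sum_lt_sum (fun j _ => ?_) ⟨i, Finset.mem_univ _, by simpa using hk⟩
      by_cases hj : j = i
      · subst hj
        simpa using hk.le
      · simp [hj]
    rcases lt_or_gt_of_ne hi with hlt | hgt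
    · exact h _ _ (adj_comm.1 (adj_update z i)) (key _ (by omega))
    · have h1 := adj_update (Function.update z i (z i - 1)) i
      simp only [Function.update_self, Function.update_idem, sub_add_cancel,
        Function.update_eq_self] at h1
      exact h _ _ h1 (key _ (by omega))

lemma toReal_dirichlet_pos (hN : N ≠ 0) (hr : 0 < r) {c : ℝ} (hc : 0 < c)
    {u : ZN N → ℝ} (hu : vsum r u ≠ ⊤) {z₀ : ZN N} (h₀ : u z₀ ≠ 0)
    (hD : dirichlet (fun _ => c) s u ≠ ⊤) : 0 < (dirichlet (fun _ => c) s u).toReal := by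
  refine ENNReal.toReal_pos (fun h => ?_) hD
  unfold dirichlet wsum at h
  rw [ENNReal.tsum_eq_zero] at h
  have hgrad : ∀ x y, adj x y → u x = u z₀ → u y = u z₀ := fun x y hxy hx => by
    by_contra hy
    have h1 := h (x, y)
    rw [ENNReal.ofReal_eq_zero] at h1
    have h2 : 0 < |grad u x y| := by
      rw [abs_pos]
      unfold grad
      rw [hx]
      exact sub_ne_zero.2 hy
    have h3 : edgeWeight (x, y) = 1 / 2 := if_pos hxy
    simp only [h3] at h1
    exact absurd h1 (not_le.2 (by positivity))
  have hconst := forall_of_adj (P := fun z => u z = u z₀) rfl hgrad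
  have hfin := finite_lt_abs_of_vsum_ne_top hr hu (ε := |u z₀| / 2) (by positivity)
  have huniv : {z | |u z₀| / 2 < |u z|} = Set.univ := by
    ext z
    simp only [Set.mem_ofPred_eq, Set.mem_univ, iff_true, hconst z]
    linarith [abs_pos.2 h₀]
  rw [huniv] at hfin
  have : Nonempty (Fin N) := ⟨⟨0, Nat.pos_of_ne_zero hN⟩⟩
  have : Infinite (ZN N) := Infinite.of_injective (Function.const (Fin N)) Function.const_injective
  exact Set.infinite_univ hfin

lemma dirichlet_le_mul_of_abs_le {K : ℝ} (hp : 0 < p) (hpq : p ≤ q) (hK : 0 ≤ K) {m : ℝ}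
    (hm : 0 ≤ m) {u : ZN N → ℝ} (hu : ∀ z, |u z| ≤ K) :
    dirichlet (fun _ => m) q u ≤
      ENNReal.ofReal ((2 * K) ^ (q - p)) * dirichlet (fun _ => m) p u := by
  rw [← dirichlet_weight_mul (by positivity)]
  refine ENNReal.tsum_le_tsum fun e => ENNReal.ofReal_le_ofReal ?_
  have h1 : |grad u e.1 e.2| ≤ 2 * K := by
    unfold grad
    linarith [abs_sub (u e.2) (u e.1), hu e.1, hu e.2]
  have h2 : |grad u e.1 e.2| ^ q = |grad u e.1 e.2| ^ (q - p) * |grad u e.1 e.2| ^ p := by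
    rcases eq_or_ne |grad u e.1 e.2| 0 with h0 | h0
    · rw [h0, Real.zero_rpow hp.ne', Real.zero_rpow (by linarith), mul_zero]
    · rw [← Real.rpow_add (lt_of_le_of_ne (abs_nonneg _) h0.symm), sub_add_cancel]
  have h3 : |grad u e.1 e.2| ^ (q - p) ≤ (2 * K) ^ (q - p) :=
    Real.rpow_le_rpow (abs_nonneg _) h1 (by linarith)
  have h4 := dirichlet_weight_nonneg (b := fun _ => m) (fun _ => hm) e
  rw [h2]
  calc _ = edgeWeight e * m * |grad u e.1 e.2| ^ p * |grad u e.1 e.2| ^ (q - p) := by ring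
    _ ≤ edgeWeight e * m * |grad u e.1 e.2| ^ p * (2 * K) ^ (q - p) := by gcongr
    _ = _ := by ring

lemma dirichlet_brezis_lieb {b : ℕ → ZN N → ℝ} {d : ZN N → ℝ} {A : ℝ}
    (hb : ∀ n z, 0 ≤ b n z) (hbA : ∀ n z, b n z ≤ A)
    (hbd : ∀ z, Tendsto (fun n => b n z) atTop (𝓝 (d z))) (hs : 1 ≤ s)
    {u : ℕ → ZN N → ℝ} {w : ZN N → ℝ} (huw : ∀ z, Tendsto (fun n => u n z) atTop (𝓝 (w z)))
    {M : ℝ} (hM : ∀ n, dirichlet (b n) s (u n) ≤ ENNReal.ofReal M)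
    (hw : dirichlet (fun _ => A) s w ≠ ⊤) :
    (∀ n, dirichlet (b n) s (fun z => u n z - w z) ≠ ⊤) ∧
    Tendsto (fun n => (dirichlet (b n) s (u n)).toReal
      - (dirichlet (b n) s (fun z => u n z - w z)).toReal) atTop (𝓝 (dirichlet d s w).toReal) := by
  have hgrad : ∀ n, (fun e : ZN N × ZN N => grad (fun z => u n z - w z) e.1 e.2) =
      fun e => grad (u n) e.1 e.2 - grad w e.1 e.2 := fun n => by
    ext e
    unfold grad
    ring
  unfold dirichlet at *
  simp only [hgrad]
  exact brezis_lieb (fun n => dirichlet_weight_nonneg (hb n))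
    (fun n e => mul_le_mul_of_nonneg_left (hbA n _) (edgeWeight_nonneg e))
    (fun e => (hbd e.1).const_mul _) hs (fun e => (huw e.2).sub (huw e.1)) hM hw

lemma le_energy_of_tendsto_weight (hp : 1 < p) (hq : 1 < q) {b : ℕ → ZN N → ℝ} {d : ZN N → ℝ}
    {A : ℝ} (hb : ∀ n z, 0 ≤ b n z) (hbA : ∀ n z, b n z ≤ A)
    (hbd : ∀ z, Tendsto (fun n => b n z) atTop (𝓝 (d z))) {S : ℝ≥0∞} {w : ZN N → ℝ}
    (hw : (Function.support w).Finite) (hS : ∀ n, S ≤ energy p q (b n) w) :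
    S ≤ energy p q d w := by
  have hq0 : 0 < q := by linarith
  have hp0 : 0 < p := by linarith
  have hA : 0 ≤ A := (hb 0 0).trans (hbA 0 0)
  have hd : ∀ z, 0 ≤ d z := fun z => ge_of_tendsto' (hbd z) fun n => hb n z
  have hA' : dirichlet (fun _ => A / q) q w ≠ ⊤ := dirichlet_ne_top (fun _ => by positivity) hq0 hw
  have hbq : ∀ n z, b n z / q ≤ A / q := fun n z => by have := hbA n z; gcongr
  have h := (dirichlet_brezis_lieb (b := fun n z => b n z / q) (d := fun z => d z / q)
    (u := fun _ => w) (w := w) (fun n z => div_nonneg (hb n z) hq0.le) hbq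
    (fun z => (hbd z).div_const q) hq.le (fun z => tendsto_const_nhds)
    (M := (dirichlet (fun _ => A / q) q w).toReal)
    (fun n => by rw [ENNReal.ofReal_toReal hA']; exact dirichlet_mono_weight (hbq n) w) hA').2
  have h0 : ∀ n, dirichlet (fun z => b n z / q) q (fun z => w z - w z) = 0 := fun n => by
    have := dirichlet_const_mul (s := q) (fun z => b n z / q) 0 w
    simp only [zero_mul, abs_zero, Real.zero_rpow hq0.ne', ENNReal.ofReal_zero] at this
    simpa using this
  simp only [h0, ENNReal.toReal_zero, sub_zero] at h
  have h1 := (ENNReal.tendsto_toReal_iff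
    (fun n => dirichlet_ne_top (fun z => div_nonneg (hb n z) hq0.le) hq0 hw)
    (dirichlet_ne_top (fun z => div_nonneg (hd z) hq0.le) hq0 hw)).1 h
  rw [energy_eq hp0 hq0 hd]
  refine ge_of_tendsto' (h1.const_add _) fun n => ?_
  rw [← energy_eq hp0 hq0 (hb n)]
  exact hS n

lemma mul_toReal_vsum_le (hp : 0 < p) (hpq : p < q) (hqr : q ≤ r) {b : ZN N → ℝ}
    (hb : ∀ z, 0 ≤ b z) {V : ℝ} (hV : 0 < V) {S : ℝ≥0∞}
    (hS : ∀ w : ZN N → ℝ, vsum r w = ENNReal.ofReal V → S ≤ energy p q b w)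
    {w : ZN N → ℝ} (hw : vsum r w ≠ ⊤) (hwV : (vsum r w).toReal ≤ V)
    (hA : dirichlet (fun _ => 1 / p) p w ≠ ⊤) (hB : dirichlet (fun z => b z / q) q w ≠ ⊤) :
    S.toReal * (vsum r w).toReal ≤ V * ((dirichlet (fun _ => 1 / p) p w).toReal +
      (dirichlet (fun z => b z / q) q w).toReal) ∧
    (0 < (vsum r w).toReal → (vsum r w).toReal < V → 0 < (dirichlet (fun _ => 1 / p) p w).toReal →
    S.toReal * (vsum r w).toReal < V * ((dirichlet (fun _ => 1 / p) p w).toReal +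
      (dirichlet (fun z => b z / q) q w).toReal)) := by
  have hq : 0 < q := hp.trans hpq
  have hr : 0 < r := hq.trans_le hqr
  rcases (ENNReal.toReal_nonneg (a := vsum r w)).eq_or_lt with h0 | h0
  · rw [← h0, mul_zero]
    exact ⟨by positivity, fun h => absurd h (lt_irrefl _)⟩
  have key := le_rescaled_energy hp hq hr hb hV hS hw h0 hA hB
  set ν := (vsum r w).toReal
  set a := (dirichlet (fun _ => 1 / p) p w).toReal with ha
  set c := (dirichlet (fun z => b z / q) q w).toReal with hc
  have ha0 : 0 ≤ a := ENNReal.toReal_nonneg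
  have hc0 : 0 ≤ c := ENNReal.toReal_nonneg
  have hρ : 1 ≤ V / ν := (one_le_div h0).2 hwV
  have hq1 : (V / ν) ^ (q / r) ≤ V / ν := by
    simpa using Real.rpow_le_rpow_of_exponent_le hρ ((div_le_one hr).2 hqr)
  have hV' : V = V / ν * ν := by field_simp
  refine ⟨?_, fun _ hlt hpos => ?_⟩
  · have hp1 : (V / ν) ^ (p / r) ≤ V / ν := by
      simpa using Real.rpow_le_rpow_of_exponent_le hρ ((div_le_one hr).2 (hpq.le.trans hqr))
    rw [hV', mul_right_comm]
    refine mul_le_mul_of_nonneg_right (key.trans ?_) h0.le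
    rw [mul_add]
    gcongr
  · have hp1 : (V / ν) ^ (p / r) < V / ν := by
      simpa using Real.rpow_lt_rpow_of_exponent_lt ((one_lt_div h0).2 hlt)
        ((div_lt_one hr).2 (hpq.trans_le hqr))
    rw [hV', mul_right_comm]
    refine mul_lt_mul_of_pos_right (key.trans_lt ?_) h0
    rw [mul_add]
    have h1 := mul_lt_mul_of_pos_right hp1 hpos
    have h2 := mul_le_mul_of_nonneg_right hq1 hc0
    linarith

end Connected

section Compactness

variable {N : ℕ} {s p q r : ℝ}

/-- A pointwise convergent minimizing sequence with a nonzero limit loses no mass at infinity. -/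
lemma minimizing_limit (hN : N ≠ 0) (hp : 1 < p) (hpq : p < q) (hqr : q ≤ r)
    {b : ℕ → ZN N → ℝ} {d : ZN N → ℝ} {A : ℝ}
    (hb : ∀ n z, 0 ≤ b n z) (hbA : ∀ n z, b n z ≤ A)
    (hbd : ∀ z, Tendsto (fun n => b n z) atTop (𝓝 (d z))) {V : ℝ} (hV : 0 < V) {S : ℝ≥0∞}
    (hS : ∀ n w, (Function.support w).Finite → vsum r w = ENNReal.ofReal V →
      S ≤ energy p q (b n) w) (hStop : S ≠ ⊤)
    {u : ℕ → ZN N → ℝ} {w : ZN N → ℝ} (huw : ∀ z, Tendsto (fun n => u n z) atTop (𝓝 (w z)))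
    (huV : ∀ n, vsum r (u n) = ENNReal.ofReal V) {z₀ : ZN N} (hw₀ : w z₀ ≠ 0)
    {M : ℝ} (hM : ∀ n, energy p q (b n) (u n) ≤ ENNReal.ofReal M)
    (huS : Tendsto (fun n => energy p q (b n) (u n)) atTop (𝓝 S)) :
    (∀ v, vsum r v = ENNReal.ofReal V → S ≤ energy p q d v) ∧
    vsum r w = ENNReal.ofReal V ∧ energy p q d w = S ∧
    dirichlet (fun _ => 1 / p) p w ≠ ⊤ ∧ dirichlet (fun z => d z / q) q w ≠ ⊤ ∧
    Tendsto (fun n => dirichlet (fun _ => 1 / p) p (fun z => u n z - w z)) atTop (𝓝 0) ∧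
    Tendsto (fun n => dirichlet (fun z => b n z / q) q (fun z => u n z - w z)) atTop (𝓝 0) := by
  have hp0 : 0 < p := by linarith
  have hq0 : 0 < q := by linarith
  have hr0 : 0 < r := by linarith
  have hA : 0 ≤ A := (hb 0 0).trans (hbA 0 0)
  have hd : ∀ z, 0 ≤ d z := fun z => ge_of_tendsto' (hbd z) fun n => hb n z
  have hdA : ∀ z, d z ≤ A := fun z => le_of_tendsto' (hbd z) fun n => hbA n z
  have hp1 : ∀ _ : ZN N, 0 ≤ 1 / p := fun _ => by positivity
  have hbq0 : ∀ n z, 0 ≤ b n z / q := fun n z => div_nonneg (hb n z) hq0.le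
  have hbq : ∀ n z, b n z / q ≤ A / q := fun n z => by have := hbA n z; gcongr
  have hbdq : ∀ z, Tendsto (fun n => b n z / q) atTop (𝓝 (d z / q)) := fun z => (hbd z).div_const q
  have hSd : ∀ v, vsum r v = ENNReal.ofReal V → S ≤ energy p q d v :=
    le_energy_of_forall_finite hp0 hpq.le hr0 hd hV fun v hv hvV =>
      le_energy_of_tendsto_weight hp (hp.trans hpq) hb hbA hbd hv fun n => hS n v hv hvV
  have hAM : ∀ n, dirichlet (fun _ => 1 / p) p (u n) ≤ ENNReal.ofReal M := fun n =>
    le_self_add.trans ((energy_eq hp0 hq0 (hb n) (u n)).symm.le.trans (hM n))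
  have hBM : ∀ n, dirichlet (fun z => b n z / q) q (u n) ≤ ENNReal.ofReal M := fun n =>
    le_add_self.trans ((energy_eq hp0 hq0 (hb n) (u n)).symm.le.trans (hM n))
  have hwV : vsum r w ≤ ENNReal.ofReal V := by
    rw [vsum_eq_wsum]
    exact wsum_le_of_tendsto (c := fun _ _ => 1) hr0.le (fun _ => tendsto_const_nhds) huw
      fun n => by rw [← vsum_eq_wsum, huV n]
  have hwtop : vsum r w ≠ ⊤ := ne_top_of_le_ne_top ENNReal.ofReal_ne_top hwV
  have hwA : dirichlet (fun _ => 1 / p) p w ≠ ⊤ := by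
    refine ne_top_of_le_ne_top (ENNReal.ofReal_ne_top (r := M)) ?_
    exact wsum_le_of_tendsto (c := fun _ e => edgeWeight e * (1 / p)) hp0.le
      (fun _ => tendsto_const_nhds) (fun e => (huw e.2).sub (huw e.1)) hAM
  have hwC : dirichlet (fun _ => A / q) q w ≠ ⊤ := by
    have h1 : dirichlet (fun _ => A / q) p w ≠ ⊤ := by
      have h2 := dirichlet_weight_mul (s := p) (show 0 ≤ A / q * p by positivity)
        (fun _ => 1 / p) w
      simp only [mul_assoc, mul_one_div_cancel hp0.ne', mul_one] at h2
      rw [h2]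
      exact ENNReal.mul_ne_top ENNReal.ofReal_ne_top hwA
    exact ne_top_of_le_ne_top (ENNReal.mul_ne_top ENNReal.ofReal_ne_top h1)
      (dirichlet_le_mul_of_abs_le hp0 hpq.le (by positivity) (by positivity)
        (abs_le_of_vsum_le hV.le hr0 hwV))
  have hwB : dirichlet (fun z => d z / q) q w ≠ ⊤ :=
    ne_top_of_le_ne_top hwC (dirichlet_mono_weight (fun z => by have := hdA z; gcongr) w)
  have hwA0 := toReal_dirichlet_pos hN hr0 (show 0 < 1 / p by positivity) hwtop hw₀ hwA
  have hν0 : 0 < (vsum r w).toReal := by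
    refine ENNReal.toReal_pos (fun h => ?_) hwtop
    unfold vsum at h
    rw [ENNReal.tsum_eq_zero] at h
    have h1 := ENNReal.ofReal_eq_zero.1 (h z₀)
    have : 0 < |w z₀| := abs_pos.2 hw₀
    exact absurd h1 (not_le.2 (by positivity))
  have hνV : (vsum r w).toReal ≤ V := ENNReal.toReal_le_of_le_ofReal hV.le hwV
  obtain ⟨hVf, hVt⟩ := brezis_lieb (c := fun _ (_ : ZN N) => 1) (C := fun _ => 1) (d := fun _ => 1)
    (fun _ _ => zero_le_one) (fun _ _ => le_rfl) (fun _ => tendsto_const_nhds)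
    (show 1 ≤ r by linarith) huw (M := V) (fun n => by rw [← vsum_eq_wsum, huV n])
    (by rwa [← vsum_eq_wsum])
  simp only [← vsum_eq_wsum, huV, ENNReal.toReal_ofReal hV.le] at hVf hVt
  obtain ⟨hAf, hAt⟩ := dirichlet_brezis_lieb (b := fun _ _ => 1 / p) (fun _ => hp1)
    (fun _ _ => le_rfl) (fun _ => tendsto_const_nhds) hp.le huw hAM hwA
  obtain ⟨hBf, hBt⟩ := dirichlet_brezis_lieb hbq0 hbq hbdq (hp.trans hpq).le huw hBM hwC
  set ν := (vsum r w).toReal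
  set α := (dirichlet (fun _ => 1 / p) p w).toReal
  set β := (dirichlet (fun z => d z / q) q w).toReal
  set νn := fun n => (vsum r fun z => u n z - w z).toReal with hνn
  set αn := fun n => (dirichlet (fun _ => 1 / p) p fun z => u n z - w z).toReal with hαn
  set βn := fun n => (dirichlet (fun z => b n z / q) q fun z => u n z - w z).toReal with hβn
  have hen : Tendsto (fun n => (energy p q (b n) (u n)).toReal) atTop (𝓝 S.toReal) :=
    (ENNReal.tendsto_toReal hStop).comp huS
  have hνt : Tendsto νn atTop (𝓝 (V - ν)) := by
    simpa using hVt.const_sub V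
  have hαβt : Tendsto (fun n => αn n + βn n) atTop (𝓝 (S.toReal - (α + β))) := by
    refine (hen.sub (hAt.add hBt)).congr fun n => ?_
    rw [energy_eq hp0 hq0 (hb n), ENNReal.toReal_add
      (ne_top_of_le_ne_top ENNReal.ofReal_ne_top (hAM n))
      (ne_top_of_le_ne_top ENNReal.ofReal_ne_top (hBM n))]
    ring
  have hrem : S.toReal * (V - ν) ≤ V * (S.toReal - (α + β)) := by
    refine le_of_tendsto_of_tendsto (hνt.const_mul _) (hαβt.const_mul _) ?_
    filter_upwards [hνt.eventually (gt_mem_nhds (show V - ν < V by linarith))] with n hn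
    exact (mul_toReal_vsum_le hp0 hpq hqr (hb n) hV
      (le_energy_of_forall_finite hp0 hpq.le hr0 (hb n) hV (hS n)) (hVf n) hn.le (hAf n) (hBf n)).1
  obtain ⟨hle, hlt⟩ := mul_toReal_vsum_le hp0 hpq hqr hd hV hSd hwtop hνV hwA hwB
  have hν : ν = V := hνV.eq_of_not_lt fun h => by
    have := hlt hν0 h hwA0
    linarith
  have hαβ : α + β = S.toReal := by
    change S.toReal * ν ≤ V * (α + β) at hle
    rw [hν] at hrem hle
    exact mul_left_cancel₀ hV.ne' (by linarith)
  rw [hαβ, sub_self] at hαβt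
  have hα0 : ∀ n, 0 ≤ αn n := fun n => ENNReal.toReal_nonneg
  have hβ0 : ∀ n, 0 ≤ βn n := fun n => ENNReal.toReal_nonneg
  refine ⟨hSd, ?_, ?_, hwA, hwB, ?_, ?_⟩
  · rw [← hν, ENNReal.ofReal_toReal hwtop]
  · rw [energy_eq hp0 hq0 hd, ← ENNReal.toReal_eq_toReal_iff' (ENNReal.add_ne_top.2 ⟨hwA, hwB⟩)
      hStop, ENNReal.toReal_add hwA hwB]
    exact hαβ
  · refine (ENNReal.tendsto_toReal_iff hAf ENNReal.zero_ne_top).1 ?_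
    exact squeeze_zero hα0 (fun n => le_add_of_nonneg_right (hβ0 n)) hαβt
  · refine (ENNReal.tendsto_toReal_iff hBf ENNReal.zero_ne_top).1 ?_
    exact squeeze_zero hβ0 (fun n => le_add_of_nonneg_left (hα0 n)) hαβt

lemma exists_tendsto_subseq {ι : Type*} [Countable ι] {u b : ℕ → ι → ℝ} {K A : ℝ}
    (hu : ∀ n z, |u n z| ≤ K) (hb : ∀ n z, 0 ≤ b n z) (hbA : ∀ n z, b n z ≤ A) :
    ∃ φ : ℕ → ℕ, StrictMono φ ∧ ∃ w d : ι → ℝ,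
      (∀ z, Tendsto (fun k => u (φ k) z) atTop (𝓝 (w z))) ∧
      ∀ z, Tendsto (fun k => b (φ k) z) atTop (𝓝 (d z)) := by
  have hc : IsCompact (Set.univ.pi fun _ : ι => Set.Icc (-K) K ×ˢ Set.Icc 0 A) :=
    isCompact_univ_pi fun _ => isCompact_Icc.prod isCompact_Icc
  obtain ⟨g, -, φ, hφ, hg⟩ := hc.tendsto_subseq (x := fun n z => (u n z, b n z))
    fun n z _ => ⟨abs_le.1 (hu n z), hb n z, hbA n z⟩
  rw [tendsto_pi_nhds] at hg
  exact ⟨φ, hφ, fun z => (g z).1, fun z => (g z).2, fun z => (hg z).fst_nhds,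
    fun z => (hg z).snd_nhds⟩

lemma exists_ne_zero_of_tendsto {u : ℕ → ZN N → ℝ} {w : ZN N → ℝ}
    (huw : ∀ z, Tendsto (fun n => u n z) atTop (𝓝 (w z))) {δ : ℝ} (hδ : 0 < δ)
    {F : Set (ZN N)} (hF : F.Finite) (h : ∀ n, ∃ z ∈ F, δ ≤ |u n z|) : ∃ z, w z ≠ 0 := by
  by_contra! h0
  have h1 : ∀ᶠ n in atTop, ∀ z ∈ F, |u n z| < δ := by
    refine (hF.eventually_all).2 fun z _ => ?_
    have := (huw z).abs
    rw [h0 z, abs_zero] at this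
    exact this.eventually (gt_mem_nhds hδ)
  obtain ⟨n, hn⟩ := h1.exists
  obtain ⟨z, hz, hzδ⟩ := h n
  exact absurd (hn z hz) (not_lt.2 hzδ)

lemma finite_sum_natAbs_le (C : ℕ) : {z : ZN N | ∑ i, (z i).natAbs ≤ C}.Finite := by
  refine (Set.finite_Icc (fun _ => -(C : ℤ)) fun _ => (C : ℤ)).subset fun z hz => ?_
  have h : ∀ i, (z i).natAbs ≤ C := fun i =>
    (Finset.single_le_sum (f := fun i => (z i).natAbs) (fun _ _ => Nat.zero_le _)
      (Finset.mem_univ i)).trans hz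
  exact ⟨fun i => by have := h i; simp only; omega, fun i => by have := h i; simp only; omega⟩

/-- The strong maximum principle. -/
lemma pos_of_Lop_eq {a u : ZN N → ℝ} (ha : ∀ z, 0 ≤ a z) {lam : ℝ}
    (hu : ∀ z, 0 ≤ u z) {z₀ : ZN N} (h₀ : u z₀ ≠ 0)
    (hL : ∀ x₀, Lop p q a u x₀ = lam * (|u x₀| ^ (r - 2) * u x₀)) (z : ZN N) : 0 < u z := by
  refine lt_of_le_of_ne (hu z) fun hz => h₀ ?_
  refine forall_of_adj (P := fun z => u z = 0) hz.symm (fun x y hxy hx => ?_) z₀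
  have h := hL x
  rw [Lop_eq, hx, mul_zero, mul_zero] at h
  simp only [sub_zero] at h
  have hnn : ∀ s : ℝ, ∀ y, 0 ≤ |u y| ^ (s - 2) * u y := fun s y => mul_nonneg (by positivity) (hu y)
  have h1 : 0 ≤ ∑ y ∈ nbrs x, (a x + a y) / 2 * (|u y| ^ (q - 2) * u y) :=
    Finset.sum_nonneg fun y _ => mul_nonneg
      (div_nonneg (add_nonneg (ha x) (ha y)) zero_le_two) (hnn q y)
  have h2 := Finset.sum_nonneg fun y (_ : y ∈ nbrs x) => hnn p y
  have h3 := (Finset.sum_eq_zero_iff_of_nonneg fun y _ => hnn p y).1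
    (le_antisymm (by linarith) h2) y (mem_nbrs.2 hxy)
  by_contra hy
  have hy0 : 0 < u y := lt_of_le_of_ne (hu y) (Ne.symm hy)
  have : 0 < |u y| := abs_pos.2 hy
  exact absurd h3 (by positivity)

end Compactness

/-- translated minimizing sequences of the constrained problem contain
subsequences converging pointwise (and in gradient modular) to a solution of the
double phase eigenvalue problem with translated weight `ã`. -/
theorem statement2 {N : ℕ} (hN : 2 ≤ N) (p q : ℝ) (hp : 1 < p) (hpN : p < (N : ℝ))
    (hpq : p < q) (pstar : ℝ) (hpstar : pstar = (N : ℝ) * p / ((N : ℝ) - p))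
    (r : ℝ) (hr : pstar < r) (hrq : q ≤ r)
    (a : ZN N → ℝ) (ha : ∀ x, 0 ≤ a x) (habd : ∃ A : ℝ, ∀ x, a x ≤ A)
    (t : ℝ) (ht : 0 < t)
    (v : ℕ → ZN N → ℝ) (hvfin : ∀ n, (Function.support (v n)).Finite)
    (hvr : ∀ n, vsum r (v n) = ENNReal.ofReal (r * t))
    (hvmin : Tendsto (fun n => energy p q a (v n)) atTop (𝓝 (Slevel p q a r t)))
    (x : ℕ → ZN N) (hx : ∀ n, |v n (x n)| = ⨆ z : ZN N, |v n z|)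
    (y : ℕ → ZN N) (hxy : ∃ C : ℕ, ∀ n, (∑ i, (x n i - y n i).natAbs) ≤ C) :
    ∃ φ : ℕ → ℕ, StrictMono φ ∧
      ∃ (u atil : ZN N → ℝ) (lam : ℝ),
        (∀ z, 0 ≤ atil z) ∧ 0 < lam ∧
        (∀ z : ZN N, Tendsto (fun k => a (z + y (φ k))) atTop (𝓝 (atil z))) ∧
        (∀ z : ZN N, Tendsto (fun k => v (φ k) (z + y (φ k))) atTop (𝓝 (u z))) ∧
        Tendsto (fun k =>
            eInt (fun x' y' =>
              |grad (fun z => v (φ k) (z + y (φ k)) - u z) x' y'| ^ p)) atTop (𝓝 0) ∧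
        Tendsto (fun k =>
            eInt (fun x' y' =>
              a (x' + y (φ k)) *
                |grad (fun z => v (φ k) (z + y (φ k)) - u z) x' y'| ^ q)) atTop (𝓝 0) ∧
        energy p q atil u = Slevel p q a r t ∧
        (∀ x₀ : ZN N, Lop p q atil u x₀ = lam * (|u x₀| ^ (r - 2) * u x₀)) ∧
        ((∀ n z, 0 ≤ v n z) → ∀ z, 0 < u z) := by
  have hp0 : 0 < p := by linarith
  have hq0 : 0 < q := by linarith
  have hr0 : 0 < r := by linarith
  have hN0 : N ≠ 0 := by omega
  subst hpstar
  have hV : 0 < r * t := by positivity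
  obtain ⟨A, hA⟩ := habd
  obtain ⟨C, hC⟩ := hxy
  have hSn : ∀ n, Slevel p q a r t ≤ energy p q a (v n) := fun n =>
    sInf_le ⟨v n, hvfin n, hvr n, rfl⟩
  have hvtop : ∀ n, energy p q a (v n) ≠ ⊤ := fun n => by
    rw [energy_eq hp0 hq0 ha]
    exact ENNReal.add_ne_top.2 ⟨dirichlet_ne_top (fun _ => by positivity) hp0 (hvfin n),
      dirichlet_ne_top (fun z => div_nonneg (ha z) hq0.le) hq0 (hvfin n)⟩
  have hStop : Slevel p q a r t ≠ ⊤ := ne_top_of_le_ne_top (hvtop 0) (hSn 0)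
  obtain ⟨M, hM⟩ : ∃ M : ℝ, ∀ n, energy p q a (v n) ≤ ENNReal.ofReal M := by
    obtain ⟨M, hM⟩ := ((ENNReal.tendsto_toReal hStop).comp hvmin).bddAbove_range
    exact ⟨M, fun n => (ENNReal.le_ofReal_iff_toReal_le (hvtop n)
      (ENNReal.toReal_nonneg.trans (hM ⟨n, rfl⟩))).2 (hM ⟨n, rfl⟩)⟩
  have hvK : ∀ n z, |v n z| ≤ (r * t) ^ (1 / r) := fun n =>
    abs_le_of_vsum_le hV.le hr0 (hvr n).le
  obtain ⟨φ, hφ, u, d, hu, hd⟩ := exists_tendsto_subseq (u := fun n z => v n (z + y n))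
    (b := fun n z => a (z + y n)) (fun n z => hvK n _) (fun n z => ha _) (fun n z => hA _)
  obtain ⟨δ, hδ, hδv⟩ := exists_le_of_vsum_eq hN hp hpN hr hV
    (E := ENNReal.ofReal p * ENNReal.ofReal M)
    (ENNReal.mul_ne_top ENNReal.ofReal_ne_top ENNReal.ofReal_ne_top)
  have hδx : ∀ n, δ ≤ |v n (x n)| := fun n => by
    refine hδv (v n) (hvfin n) (hvr n) ?_ _ fun z => ?_
    · have h1 := dirichlet_weight_mul (s := p) hp0.le (fun _ => 1 / p) (v n)
      simp only [mul_one_div_cancel hp0.ne'] at h1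
      rw [eInt_rpow_eq, h1]
      gcongr
      exact le_self_add.trans ((energy_eq hp0 hq0 ha (v n)).symm.le.trans (hM n))
    · rw [hx n]
      exact le_ciSup (f := fun z => |v n z|) ⟨_, Set.forall_mem_range.2 (hvK n)⟩ z
  obtain ⟨z₀, hz₀⟩ := exists_ne_zero_of_tendsto hu hδ (finite_sum_natAbs_le C) fun k =>
    ⟨x (φ k) - y (φ k), hC (φ k), by simpa using hδx (φ k)⟩
  have hen : ∀ n, energy p q (fun z => a (z + y n)) (fun z => v n (z + y n)) =
      energy p q a (v n) := fun n => energy_translate a (y n) (v n)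
  have hS : ∀ k w, (Function.support w).Finite → vsum r w = ENNReal.ofReal (r * t) →
      Slevel p q a r t ≤ energy p q (fun z => a (z + y (φ k))) w := fun k w hw hwV => by
    refine sInf_le ⟨fun z => w (z + -y (φ k)), ?_, ?_, ?_⟩
    · exact hw.preimage (f := fun z => z + -y (φ k)) (add_left_injective _).injOn
    · rw [vsum_translate, hwV]
    · rw [← energy_translate a (y (φ k))]
      simp
  obtain ⟨hSd, huV, huS, huA, huB, hlimA, hlimB⟩ := minimizing_limit hN0 hp hpq hrq
    (fun k z => ha (z + y (φ k))) (fun k z => hA _) hd hV hS hStop hu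
    (fun k => by rw [vsum_translate, hvr]) hz₀ (M := M) (fun k => by rw [hen]; exact hM _)
    (by simp only [hen]; exact hvmin.comp hφ.tendsto_atTop)
  have hd0 : ∀ z, 0 ≤ d z := fun z => ge_of_tendsto' (hd z) fun k => ha _
  have hEL := Lop_eq_of_isMinimizer hp (hp.trans hpq) (by linarith) hd0 hV hSd huV huA huB huS
  have huA0 := toReal_dirichlet_pos hN0 hr0 (show 0 < 1 / p by positivity)
    (by rw [huV]; exact ENNReal.ofReal_ne_top) hz₀ huA
  refine ⟨φ, hφ, u, d, _, hd0, by positivity, hd, hu, ?_, ?_, huS, hEL,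
    fun hv => pos_of_Lop_eq hd0 (fun z => ge_of_tendsto' (hu z) fun k => hv _ _) hz₀ hEL⟩
  · have h1 := fun k => dirichlet_weight_mul (s := p) hp0.le (fun _ => 1 / p)
      (fun z => v (φ k) (z + y (φ k)) - u z)
    simp only [mul_one_div_cancel hp0.ne'] at h1
    simp only [eInt_rpow_eq, h1]
    simpa using ENNReal.Tendsto.const_mul hlimA (Or.inr (ENNReal.ofReal_ne_top (r := p)))
  · have h1 := fun k => dirichlet_weight_mul (s := q) hq0.le (fun z => a (z + y (φ k)) / q)
      (fun z => v (φ k) (z + y (φ k)) - u z)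
    simp only [mul_div_cancel₀ _ hq0.ne'] at h1
    have h2 := fun k => eInt_mul_rpow_eq (fun z => a (z + y (φ k))) q
      (fun z => v (φ k) (z + y (φ k)) - u z)
    simp only [h2, h1]
    simpa using ENNReal.Tendsto.const_mul hlimB (Or.inr (ENNReal.ofReal_ne_top (r := q)))
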